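/- Let N ≥ 2, let s, t be real numbers with -∞ < s ≤ t < N, and let 0 < α < α_{N,t} := (N-t)·ω_{N-1}^{1/(N-1)}. Define G_{N,s,t,α}(u) := (∫_{ℝ^N} e^{α|u|^{N/(N-1)}} |u|^N |x|^{-t} dx) / (∫_{ℝ^N} |u|^N |x|^{-s} dx)^{(N-t)/(N-s)} and ν_{N,s,t,α,rad}(ℝ^N) := sup { G_{N,s,t,α}(u) : u ∈ X^{1,N}_{s,rad}, ∫_{ℝ^N}|∇u|^N dx = 1 }. Then the supremum ν_{N,s,t,α,rad}(ℝ^N) is attained: there exists a radially symmetric u ∈ X^{1,N}_{s,rad} with ∫_{ℝ^N}|∇u|^N dx = 1 and G_{N,s,t,α}(u) = ν_{N,s,t,α,rad}(ℝ^N). -/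

import Mathlib

open MeasureTheory Real ENNReal

/-- Surface area of the unit sphere `S^{N-1}` in `ℝ^N`, i.e. `ω_{N-1} = N · vol(B(0,1))`. -/
noncomputable def sphereArea (N : ℕ) : ℝ :=
  N * (volume (Metric.ball (0 : EuclideanSpace ℝ (Fin N)) 1)).toReal

/-- `Φ_N(τ) = Σ_{j ≥ N-1} τ^j / j!`, the exponential series with the first `N-1` terms removed. -/
noncomputable def PhiN (N : ℕ) (τ : ℝ) : ℝ :=
  ∑' j : ℕ, τ ^ (j + (N - 1)) / (Nat.factorial (j + (N - 1)) : ℝ)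

/-- `g` is the weak gradient of `u` on `ℝ^N`: both are locally integrable and the
integration-by-parts identity holds against all smooth compactly supported test functions. -/
def HasWeakGradient {N : ℕ} (u : EuclideanSpace ℝ (Fin N) → ℝ)
    (g : EuclideanSpace ℝ (Fin N) → EuclideanSpace ℝ (Fin N)) : Prop :=
  LocallyIntegrable u volume ∧ LocallyIntegrable g volume ∧
  ∀ φ : EuclideanSpace ℝ (Fin N) → ℝ, ContDiff ℝ (⊤ : ℕ∞) φ → HasCompactSupport φ →
    ∀ i : Fin N,
      ∫ x, u x * fderiv ℝ φ x (EuclideanSpace.single i 1) = - ∫ x, g x i * φ x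

/-- `u ∈ X^{1,N}_{s,rad}` with `∫|∇u|^N = 1`: `u` is radially symmetric, has a weak gradient
`g` with `∫‖g‖^N dx = 1`, and `∫|u|^N |x|^{-s} dx < ∞`. -/
def AdmissibleXrad (N : ℕ) (s : ℝ) (u : EuclideanSpace ℝ (Fin N) → ℝ) : Prop :=
  (∀ x y : EuclideanSpace ℝ (Fin N), ‖x‖ = ‖y‖ → u x = u y) ∧
  (∃ g : EuclideanSpace ℝ (Fin N) → EuclideanSpace ℝ (Fin N),
    HasWeakGradient u g ∧ (∫⁻ x, ENNReal.ofReal (‖g x‖ ^ (N : ℝ))) = 1) ∧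
  (∫⁻ x, ENNReal.ofReal (|u x| ^ (N : ℝ) * ‖x‖ ^ (-s))) ≠ ⊤

/-- The functional `G_{N,s,t,α}(u)` of (1.6), valued in `[0,∞]`. -/
noncomputable def Gfunc (N : ℕ) (s t α : ℝ) (u : EuclideanSpace ℝ (Fin N) → ℝ) : ℝ≥0∞ :=
  (∫⁻ x, ENNReal.ofReal
      (Real.exp (α * |u x| ^ ((N : ℝ) / ((N : ℝ) - 1))) * |u x| ^ (N : ℝ) * ‖x‖ ^ (-t))) /
    (∫⁻ x, ENNReal.ofReal (|u x| ^ (N : ℝ) * ‖x‖ ^ (-s))) ^ (((N : ℝ) - t) / ((N : ℝ) - s))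

section

open Set Filter Topology

/-- Hölder's inequality against the constant function `1`. -/
theorem lintegral_le_rpow_mul_measure_univ {β : Type*} [MeasurableSpace β] {μ : Measure β}
    {f : β → ℝ≥0∞} (hf : AEMeasurable f μ) {p : ℝ} (hp : 1 < p) :
    ∫⁻ x, f x ∂μ ≤ (∫⁻ x, f x ^ p ∂μ) ^ (1 / p) * μ univ ^ (1 - 1 / p) := by
  have hpq : p.HolderConjugate (p.conjExponent) := Real.HolderConjugate.conjExponent hp
  have := ENNReal.lintegral_mul_le_Lp_mul_Lq μ hpq hf (aemeasurable_const (b := (1 : ℝ≥0∞)))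
  simp only [Pi.mul_apply, mul_one, ENNReal.one_rpow, lintegral_const, one_mul] at this
  have e : 1 / p.conjExponent = 1 - 1 / p := by
    have := hpq.inv_add_inv_eq_one
    simp only [one_div]; linarith
  rwa [e] at this

/-- `h` is a primitive of a function `G` with `∫ |G|^p ≤ E`. -/
def HasEnergyLE (p : ℝ) (E : ℝ≥0∞) (h : ℝ → ℝ) : Prop :=
  ∃ G : ℝ → ℝ, Measurable G ∧ ∫⁻ x, ‖G x‖ₑ ^ p ≤ E ∧ ∀ a b, h b - h a = ∫ x in a..b, G x

theorem setLIntegral_enorm_le {p : ℝ} (hp : 1 < p) {E : ℝ≥0∞} {G : ℝ → ℝ} (hG : Measurable G)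
    (hE : ∫⁻ x, ‖G x‖ₑ ^ p ≤ E) (S : Set ℝ) :
    ∫⁻ x in S, ‖G x‖ₑ ≤ E ^ (1 / p) * volume S ^ (1 - 1 / p) := by
  refine (lintegral_le_rpow_mul_measure_univ hG.enorm.aemeasurable hp).trans ?_
  rw [Measure.restrict_apply_univ]
  gcongr
  exact (setLIntegral_le_lintegral _ _).trans hE

theorem intervalIntegrable_of_lintegral_rpow {p : ℝ} (hp : 1 < p) {E : ℝ≥0∞} (hE' : E ≠ ⊤)
    {G : ℝ → ℝ} (hG : Measurable G) (hE : ∫⁻ x, ‖G x‖ₑ ^ p ≤ E) (a b : ℝ) :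
    IntervalIntegrable G volume a b := by
  rw [intervalIntegrable_iff]
  refine ⟨hG.aestronglyMeasurable, ?_⟩
  refine (setLIntegral_enorm_le hp hG hE _).trans_lt ?_
  have h1 : 1 / p < 1 := by rw [div_lt_one] <;> linarith
  refine ENNReal.mul_lt_top (ENNReal.rpow_lt_top_of_nonneg (by positivity) hE') ?_
  exact ENNReal.rpow_lt_top_of_nonneg (by linarith) (by simp [uIoc])

theorem enorm_intervalIntegral_le (G : ℝ → ℝ) (a b : ℝ) :
    ‖∫ x in a..b, G x‖ₑ ≤ ∫⁻ x in uIoc a b, ‖G x‖ₑ := by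
  rw [intervalIntegral.intervalIntegral_eq_integral_uIoc]
  refine le_trans (le_of_eq ?_) (enorm_integral_le_lintegral_enorm _)
  split_ifs <;> simp

theorem volume_uIoc' (a b : ℝ) : volume (uIoc a b) = ENNReal.ofReal |b - a| := by
  simp [uIoc, max_sub_min_eq_abs]

namespace HasEnergyLE

variable {p : ℝ} {E : ℝ≥0∞} {h : ℝ → ℝ}

theorem enorm_sub_le (hp : 1 < p) (hh : HasEnergyLE p E h) (a b : ℝ) :
    ‖h b - h a‖ₑ ≤ E ^ (1 / p) * ENNReal.ofReal |b - a| ^ (1 - 1 / p) := by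
  obtain ⟨G, hG, hE, hd⟩ := hh
  rw [hd, ← volume_uIoc']
  exact (enorm_intervalIntegral_le _ _ _).trans (setLIntegral_enorm_le hp hG hE _)

theorem abs_sub_le (hp : 1 < p) (hE' : E ≠ ⊤) (hh : HasEnergyLE p E h) (a b : ℝ) :
    |h b - h a| ≤ E.toReal ^ (1 / p) * |b - a| ^ (1 - 1 / p) := by
  have h1 : 1 / p < 1 := by rw [div_lt_one] <;> linarith
  have := hh.enorm_sub_le hp a b
  rw [← ENNReal.ofReal_toReal hE', ENNReal.ofReal_rpow_of_nonneg (by positivity) (by positivity),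
    ENNReal.ofReal_rpow_of_nonneg (by positivity) (by linarith),
    ← ENNReal.ofReal_mul (by positivity), Real.enorm_eq_ofReal_abs,
    ENNReal.ofReal_le_ofReal_iff (by positivity)] at this
  simpa using this

theorem continuous (hp : 1 < p) (hE' : E ≠ ⊤) (hh : HasEnergyLE p E h) : Continuous h := by
  have h1 : 1 / p < 1 := by rw [div_lt_one] <;> linarith
  rw [continuous_iff_continuousAt]
  intro a
  rw [ContinuousAt, tendsto_iff_dist_tendsto_zero]
  have hc : Tendsto (fun b : ℝ => E.toReal ^ (1 / p) * |b - a| ^ (1 - 1 / p)) (𝓝 a) (𝓝 0) := by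
    have : Continuous (fun b : ℝ => E.toReal ^ (1 / p) * |b - a| ^ (1 - 1 / p)) := by
      refine continuous_const.mul (Continuous.rpow_const (by fun_prop) fun _ => Or.inr (by linarith))
    have h2 := this.tendsto a
    simpa [Real.zero_rpow (by linarith : (1 - 1 / p) ≠ 0), Real.zero_rpow (by simp at h1; linarith : (1 - p⁻¹) ≠ 0)] using h2
  refine squeeze_zero (fun _ => dist_nonneg) (fun b => ?_) hc
  rw [Real.dist_eq]
  exact hh.abs_sub_le hp hE' a b

theorem sum_abs_sub_le (hp : 1 < p) (hE' : E ≠ ⊤) (hh : HasEnergyLE p E h) {a b : ℝ}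
    {I : ℕ × (ℕ → ℝ × ℝ)} (hI : I ∈ AbsolutelyContinuousOnInterval.disjWithin a b) :
    ∑ i ∈ Finset.range I.1, dist (h (I.2 i).1) (h (I.2 i).2) ≤
      E.toReal ^ (1 / p) * (∑ i ∈ Finset.range I.1, dist (I.2 i).1 (I.2 i).2) ^ (1 - 1 / p) := by
  have h1 : 1 / p < 1 := by rw [div_lt_one] <;> linarith
  obtain ⟨G, hG, hE, hd⟩ := hh
  have hnn : 0 ≤ ∑ i ∈ Finset.range I.1, dist (I.2 i).1 (I.2 i).2 :=
    Finset.sum_nonneg fun _ _ => dist_nonneg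
  have key : ∑ i ∈ Finset.range I.1, ‖h (I.2 i).2 - h (I.2 i).1‖ₑ ≤
      E ^ (1 / p) * (∑ i ∈ Finset.range I.1, volume (uIoc (I.2 i).1 (I.2 i).2)) ^ (1 - 1 / p) := by
    calc _ ≤ ∑ i ∈ Finset.range I.1, ∫⁻ x in uIoc (I.2 i).1 (I.2 i).2, ‖G x‖ₑ := by
            refine Finset.sum_le_sum fun i _ => ?_
            rw [hd]; exact enorm_intervalIntegral_le _ _ _
      _ = ∫⁻ x in ⋃ i ∈ Finset.range I.1, uIoc (I.2 i).1 (I.2 i).2, ‖G x‖ₑ := by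
            rw [lintegral_biUnion_finset hI.2 (fun _ _ => measurableSet_uIoc)]
      _ ≤ _ := setLIntegral_enorm_le hp hG hE _
      _ = _ := by rw [measure_biUnion_finset hI.2 (fun _ _ => measurableSet_uIoc)]
  simp only [volume_uIoc', Real.enorm_eq_ofReal_abs] at key
  rw [← ENNReal.ofReal_sum_of_nonneg (fun _ _ => abs_nonneg _),
    ← ENNReal.ofReal_sum_of_nonneg (fun _ _ => abs_nonneg _),
    ← ENNReal.ofReal_toReal hE', ENNReal.ofReal_rpow_of_nonneg (by positivity) (by positivity),
    ENNReal.ofReal_rpow_of_nonneg (Finset.sum_nonneg fun _ _ => abs_nonneg _) (by linarith),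
    ← ENNReal.ofReal_mul (by positivity), 
    ENNReal.ofReal_le_ofReal_iff (mul_nonneg (by positivity) (Real.rpow_nonneg (Finset.sum_nonneg fun _ _ => abs_nonneg _) _))] at key
  simpa [Real.dist_eq, abs_sub_comm] using key

theorem lintegral_shift_sub_le (hp : 1 < p) (hh : HasEnergyLE p E h) {ε : ℝ} (hε : 0 < ε) :
    ∫⁻ x, ‖h (x + ε) - h x‖ₑ ^ p ≤ E * ENNReal.ofReal ε ^ p := by
  obtain ⟨G, hG, hE, hd⟩ := hh
  have hp0 : 0 < p := by linarith
  have h1 (x : ℝ) : ‖h (x + ε) - h x‖ₑ ^ p ≤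
      ENNReal.ofReal ε ^ (p - 1) * ∫⁻ y in Ioc 0 ε, ‖G (x + y)‖ₑ ^ p := by
    have e : ∫ y in x..x + ε, G y = ∫ y in (0 : ℝ)..ε, G (x + y) := by simp
    rw [hd, e]
    have h2 := lintegral_le_rpow_mul_measure_univ (μ := volume.restrict (uIoc 0 ε))
      (hG.comp (measurable_const_add x)).enorm.aemeasurable hp
    have h3 := (enorm_intervalIntegral_le (fun y => G (x + y)) 0 ε).trans h2
    have h4 := ENNReal.rpow_le_rpow h3 hp0.le
    rw [ENNReal.mul_rpow_of_nonneg _ _ hp0.le, ← ENNReal.rpow_mul, ← ENNReal.rpow_mul] at h4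
    have e1 : 1 / p * p = 1 := by field_simp
    have e2 : (1 - 1 / p) * p = p - 1 := by field_simp
    rw [e1, e2, ENNReal.rpow_one, Measure.restrict_apply_univ, volume_uIoc',
      uIoc_of_le hε.le, sub_zero, abs_of_pos hε, mul_comm] at h4
    exact h4
  have hm : Measurable (fun z : ℝ × ℝ => ‖G (z.1 + z.2)‖ₑ ^ p) :=
    (hG.comp (measurable_fst.add measurable_snd)).enorm.pow_const p
  calc _ ≤ ∫⁻ x, ENNReal.ofReal ε ^ (p - 1) * ∫⁻ y in Ioc 0 ε, ‖G (x + y)‖ₑ ^ p :=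
        lintegral_mono h1
    _ = ENNReal.ofReal ε ^ (p - 1) * ∫⁻ x, ∫⁻ y in Ioc 0 ε, ‖G (x + y)‖ₑ ^ p := by
        rw [lintegral_const_mul]
        exact hm.lintegral_prod_right'
    _ = ENNReal.ofReal ε ^ (p - 1) * ∫⁻ y in Ioc 0 ε, ∫⁻ x, ‖G (x + y)‖ₑ ^ p := by
        rw [lintegral_lintegral_swap hm.aemeasurable]
    _ = ENNReal.ofReal ε ^ (p - 1) * ∫⁻ y in Ioc 0 ε, ∫⁻ x, ‖G x‖ₑ ^ p := by
        congr 2 with y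
        exact lintegral_add_right_eq_self (fun x => ‖G x‖ₑ ^ p) y
    _ ≤ ENNReal.ofReal ε ^ (p - 1) * (E * ENNReal.ofReal ε) := by
        rw [setLIntegral_const, Real.volume_Ioc, sub_zero]
        gcongr
    _ = E * ENNReal.ofReal ε ^ p := by
        have : ENNReal.ofReal ε ^ p = ENNReal.ofReal ε ^ (p - 1) * ENNReal.ofReal ε := by
          conv_rhs => rw [← ENNReal.rpow_one (ENNReal.ofReal ε), ← ENNReal.rpow_mul, one_mul]
          rw [← ENNReal.rpow_add _ _ (by simpa using hε) (by simp)]; simp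
        rw [this]; ring

/-- The energy bound passes to pointwise limits. -/
theorem of_tendsto (hp : 1 < p) (hE' : E ≠ ⊤) {f : ℕ → ℝ → ℝ} (hf : ∀ n, HasEnergyLE p E (f n))
    (hlim : ∀ x, Tendsto (fun n => f n x) atTop (𝓝 (h x))) : HasEnergyLE p E h := by
  have hp0 : 0 < p := by linarith
  have h1 : 1 / p < 1 := by rw [div_lt_one] <;> linarith
  have hac (a b : ℝ) : AbsolutelyContinuousOnInterval h a b := by
    rw [absolutelyContinuousOnInterval_iff]
    intro ε hε
    have ht : Tendsto (fun y : ℝ => E.toReal ^ (1 / p) * y ^ (1 - 1 / p)) (𝓝 0) (𝓝 0) := by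
      have : Continuous (fun y : ℝ => E.toReal ^ (1 / p) * y ^ (1 - 1 / p)) :=
        continuous_const.mul (Continuous.rpow_const (by fun_prop) fun _ => Or.inr (by linarith))
      have h2 := this.tendsto 0
      rwa [Real.zero_rpow (by linarith), mul_zero] at h2
    obtain ⟨δ, hδ, hδ'⟩ := Metric.eventually_nhds_iff.1 (ht.eventually (gt_mem_nhds hε))
    refine ⟨δ, hδ, fun I hI hsum => ?_⟩
    have hlim' : Tendsto (fun n => ∑ i ∈ Finset.range I.1, dist (f n (I.2 i).1) (f n (I.2 i).2))
        atTop (𝓝 (∑ i ∈ Finset.range I.1, dist (h (I.2 i).1) (h (I.2 i).2))) :=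
      tendsto_finsetSum _ fun i _ => (hlim _).dist (hlim _)
    refine (le_of_tendsto' hlim' fun n => (hf n).sum_abs_sub_le hp hE' hI).trans_lt ?_
    apply hδ'
    rwa [Real.dist_eq, sub_zero, abs_of_nonneg (Finset.sum_nonneg fun _ _ => dist_nonneg)]
  have hcont : Continuous h := by
    rw [continuous_iff_continuousAt]
    intro x
    exact (hac (x - 1) (x + 1)).continuousOn.continuousAt
      (by rw [uIcc_of_le (by linarith)]; exact Icc_mem_nhds (by linarith) (by linarith))
  have hshift {ε : ℝ} (hε : 0 < ε) :
      ∫⁻ x, ‖h (x + ε) - h x‖ₑ ^ p ≤ E * ENNReal.ofReal ε ^ p := by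
    have e (x : ℝ) : liminf (fun n => ‖f n (x + ε) - f n x‖ₑ ^ p) atTop =
        ‖h (x + ε) - h x‖ₑ ^ p := by
      refine Tendsto.liminf_eq ?_
      exact (((hlim _).sub (hlim _)).enorm).ennrpow_const p
    calc _ = ∫⁻ x, liminf (fun n => ‖f n (x + ε) - f n x‖ₑ ^ p) atTop := by simp_rw [e]
      _ ≤ liminf (fun n => ∫⁻ x, ‖f n (x + ε) - f n x‖ₑ ^ p) atTop := by
          refine lintegral_liminf_le fun n => ?_
          have := (hf n).continuous hp hE'
          exact ((this.comp (continuous_add_const ε)).sub this).measurable.enorm.pow_const p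
      _ ≤ liminf (fun _ : ℕ => E * ENNReal.ofReal ε ^ p) atTop :=
          liminf_le_liminf (Eventually.of_forall fun n => (hf n).lintegral_shift_sub_le hp hε)
      _ = _ := by simp
  refine ⟨deriv h, measurable_deriv h, ?_, fun a b => ((hac a b).integral_deriv_eq_sub).symm⟩
  have hdiff : ∀ᵐ x, DifferentiableAt ℝ h x := by
    have : ∀ n : ℕ, ∀ᵐ x, x ∈ uIcc (-(n : ℝ)) n → DifferentiableAt ℝ h x := fun n =>
      (hac (-(n : ℝ)) n).ae_differentiableAt
    filter_upwards [ae_all_iff.2 this] with x hx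
    obtain ⟨n, hn⟩ := exists_nat_ge |x|
    exact hx n (by rw [uIcc_of_le (by linarith [abs_nonneg x])]; exact abs_le.1 hn)
  let ε : ℕ → ℝ := fun n => 1 / ((n : ℝ) + 1)
  have hε (n) : 0 < ε n := by positivity
  have hε0 : Tendsto ε atTop (𝓝[>] 0) := 
    tendsto_nhdsWithin_iff.2 ⟨tendsto_one_div_add_atTop_nhds_zero_nat, Eventually.of_forall hε⟩
  calc ∫⁻ x, ‖deriv h x‖ₑ ^ p
      = ∫⁻ x, liminf (fun n => ‖(ε n)⁻¹ * (h (x + ε n) - h x)‖ₑ ^ p) atTop := by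
        refine lintegral_congr_ae (hdiff.mono fun x hx => ?_)
        refine (Tendsto.liminf_eq ?_).symm
        have h3 := hx.hasDerivAt.tendsto_slope_zero
        have h4 := h3.comp (hε0.mono_right (nhdsWithin_mono 0 fun y hy => ne_of_gt hy))
        exact h4.enorm.ennrpow_const p
    _ ≤ liminf (fun n => ∫⁻ x, ‖(ε n)⁻¹ * (h (x + ε n) - h x)‖ₑ ^ p) atTop := by
        refine lintegral_liminf_le fun n => ?_
        exact (((hcont.comp (continuous_add_const (ε n))).sub hcont).measurable.const_mul
          _).enorm.pow_const p
    _ ≤ liminf (fun _ : ℕ => E) atTop := by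
        refine liminf_le_liminf (Eventually.of_forall fun n => ?_)
        simp_rw [enorm_mul, ENNReal.mul_rpow_of_nonneg _ _ hp0.le]
        have hm : Measurable fun x => ‖h (x + ε n) - h x‖ₑ ^ p :=
          ((hcont.comp (continuous_add_const (ε n))).sub hcont).measurable.enorm.pow_const p
        rw [lintegral_const_mul _ hm]
        refine (mul_le_mul_right (hshift (hε n)) _).trans ?_
        rw [Real.enorm_eq_ofReal (by positivity), ENNReal.ofReal_inv_of_pos (hε n),
          ENNReal.inv_rpow, mul_left_comm, ENNReal.inv_mul_cancel, mul_one]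
        · simp [hp0, hε n]
        · exact ENNReal.rpow_ne_top_of_nonneg hp0.le (by simp)
    _ = E := by simp

end HasEnergyLE

namespace HasEnergyLE

variable {p : ℝ} {E : ℝ≥0∞} {h : ℝ → ℝ}

theorem comp_add (hh : HasEnergyLE p E h) (c : ℝ) : HasEnergyLE p E (fun x => h (x + c)) := by
  obtain ⟨G, hG, hE, hd⟩ := hh
  refine ⟨fun x => G (x + c), hG.comp (measurable_add_const c), ?_, fun a b => ?_⟩
  · rwa [lintegral_add_right_eq_self (fun x => ‖G x‖ₑ ^ p) c]
  · simp [hd]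

/-- A function with bounded energy and bounded weighted norm decays exponentially. -/
theorem exists_exp_decay (hp : 1 < p) (hE' : E ≠ ⊤) {a : ℝ} (ha : 0 < a) :
    ∃ C c : ℝ, 0 < C ∧ 0 < c ∧ ∀ h : ℝ → ℝ, HasEnergyLE p E h →
      ∫⁻ x, ENNReal.ofReal (|h x| ^ p * Real.exp (a * x)) ≤ 1 →
      ∀ x, |h x| ≤ C * Real.exp (-(c * x)) := by
  have hp0 : 0 < p := by linarith
  set θ := 1 - 1 / p with hθ
  have hθ0 : 0 < θ := by rw [hθ, sub_pos, div_lt_one hp0]; exact hp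
  set K := E.toReal ^ (1 / p) + 1 with hK
  have hK0 : 0 < K := by positivity
  refine ⟨2 * (K ^ (1 / θ)) ^ (1 / (p + 1 / θ)), a / (p + 1 / θ), by positivity, by positivity,
    fun h hh hB x => ?_⟩
  by_cases hM : |h x| = 0
  · rw [hM]; positivity
  set M := |h x| with hMdef
  have hM0 : 0 < M := lt_of_le_of_ne (abs_nonneg _) (Ne.symm hM)
  set l := (M / 2 / K) ^ (1 / θ) with hl
  have hl0 : 0 < l := by positivity
  have hlow : ∀ y ∈ Icc x (x + l), (M / 2) ^ p * Real.exp (a * x) ≤ |h y| ^ p * Real.exp (a * y) := by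
    intro y hy
    have h1 : |h y - h x| ≤ M / 2 := by
      refine (hh.abs_sub_le hp hE' x y).trans ?_
      have h2 : |y - x| ^ θ ≤ M / 2 / K := by
        have : |y - x| ≤ l := by rw [abs_of_nonneg (by linarith [hy.1])]; linarith [hy.2]
        calc |y - x| ^ θ ≤ l ^ θ := Real.rpow_le_rpow (abs_nonneg _) this hθ0.le
          _ = M / 2 / K := by
            rw [hl, ← Real.rpow_mul (by positivity), one_div_mul_cancel hθ0.ne', Real.rpow_one]
      calc _ ≤ K * (M / 2 / K) := by
            refine mul_le_mul (by rw [hK]; linarith) h2 (by positivity) hK0.le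
        _ = M / 2 := by field_simp
    have h3 : M / 2 ≤ |h y| := by
      have := abs_sub_abs_le_abs_sub (h x) (h y)
      rw [abs_sub_comm] at this
      linarith
    have : a * x ≤ a * y := mul_le_mul_of_nonneg_left hy.1 ha.le
    gcongr
  have hint : ENNReal.ofReal ((M / 2) ^ p * Real.exp (a * x) * l) ≤ 1 := by
    calc ENNReal.ofReal ((M / 2) ^ p * Real.exp (a * x) * l)
        = ∫⁻ y in Icc x (x + l), ENNReal.ofReal ((M / 2) ^ p * Real.exp (a * x)) := by
          rw [setLIntegral_const, Real.volume_Icc, ← ENNReal.ofReal_mul (by positivity)]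
          simp
      _ ≤ ∫⁻ y in Icc x (x + l), ENNReal.ofReal (|h y| ^ p * Real.exp (a * y)) :=
          setLIntegral_mono' measurableSet_Icc fun y hy => ENNReal.ofReal_le_ofReal (hlow y hy)
      _ ≤ _ := setLIntegral_le_lintegral _ _
      _ ≤ 1 := hB
  rw [ENNReal.ofReal_le_one] at hint
  have h4 : (M / 2) ^ (p + 1 / θ) ≤ K ^ (1 / θ) * Real.exp (-(a * x)) := by
    rw [hl, Real.div_rpow (by positivity) hK0.le] at hint
    rw [Real.rpow_add (by positivity), Real.exp_neg, ← div_eq_mul_inv, le_div_iff₀ (by positivity)]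
    have hKp : 0 < K ^ (1 / θ) := by positivity
    have := mul_le_mul_of_nonneg_right hint hKp.le
    rw [one_mul] at this
    refine le_trans (le_of_eq ?_) this
    field_simp
  have h5 := Real.rpow_le_rpow (by positivity) h4 (by positivity : 0 ≤ 1 / (p + 1 / θ))
  rw [← Real.rpow_mul (by positivity), mul_one_div_cancel (by positivity), Real.rpow_one,
    Real.mul_rpow (by positivity) (by positivity), ← Real.exp_mul] at h5
  have e : -(a * x) * (1 / (p + 1 / θ)) = -(a / (p + 1 / θ) * x) := by ring
  rw [e] at h5
  linarith

theorem exists_subseq_tendsto (hp : 1 < p) (hE' : E ≠ ⊤) {f : ℕ → ℝ → ℝ}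
    (hf : ∀ n, HasEnergyLE p E (f n)) {M : ℝ → ℝ} (hM : ∀ n x, |f n x| ≤ M x) :
    ∃ φ : ℕ → ℕ, StrictMono φ ∧ ∃ g : ℝ → ℝ, ∀ x,
      Tendsto (fun n => f (φ n) x) atTop (𝓝 (g x)) := by
  have h1 : 1 / p < 1 := by rw [div_lt_one] <;> linarith
  have hK : IsCompact (univ.pi fun r : ℚ => Icc (-M r) (M r)) :=
    isCompact_univ_pi fun _ => isCompact_Icc
  obtain ⟨g, -, φ, hφ, hg⟩ := hK.tendsto_subseq (x := fun n (r : ℚ) => f n r)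
    fun n r _ => abs_le.1 (hM n r)
  rw [tendsto_pi_nhds] at hg
  refine ⟨φ, hφ, ?_⟩
  suffices ∀ x, ∃ y, Tendsto (fun n => f (φ n) x) atTop (𝓝 y) by
    choose g hg using this
    exact ⟨g, hg⟩
  intro x
  refine cauchySeq_tendsto_of_complete ?_
  rw [Metric.cauchySeq_iff']
  intro ε hε
  have hc : Tendsto (fun y : ℝ => E.toReal ^ (1 / p) * |y - x| ^ (1 - 1 / p)) (𝓝 x) (𝓝 0) := by
    have : Continuous (fun y : ℝ => E.toReal ^ (1 / p) * |y - x| ^ (1 - 1 / p)) :=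
      continuous_const.mul (Continuous.rpow_const (by fun_prop) fun _ => Or.inr (by linarith))
    have h2 := this.tendsto x
    rwa [sub_self, abs_zero, Real.zero_rpow (by linarith), mul_zero] at h2
  obtain ⟨r, hr⟩ : ∃ r : ℚ, E.toReal ^ (1 / p) * |(r : ℝ) - x| ^ (1 - 1 / p) < ε / 3 := by
    have hev := hc.eventually (gt_mem_nhds (by positivity : (0 : ℝ) < ε / 3))
    obtain ⟨δ, hδ, hb⟩ := Metric.eventually_nhds_iff.1 hev
    obtain ⟨r, hr⟩ := Rat.denseRange_cast.exists_dist_lt x hδ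
    exact ⟨r, hb (by rwa [dist_comm])⟩
  obtain ⟨n₀, hn₀⟩ := Metric.cauchySeq_iff'.1 (hg r).cauchySeq (ε / 3) (by positivity)
  refine ⟨n₀, fun n hn => ?_⟩
  have a1 := (hf (φ n)).abs_sub_le hp hE' x r
  have a2 := (hf (φ n₀)).abs_sub_le hp hE' x r
  have a3 := hn₀ n hn
  simp only [Function.comp, Real.dist_eq] at a3 ⊢
  rw [abs_lt] at *
  rw [abs_le] at a1 a2
  constructor <;> linarith

end HasEnergyLE

theorem integrableOn_exp_growth {p α b C K : ℝ} (hp : 1 < p) (hC : 0 ≤ C) (hK : 0 ≤ K)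
    (hb : α * K ^ (p / (p - 1)) < b) (T : ℝ) :
    IntegrableOn (fun x : ℝ => Real.exp (α * (C + K * |x| ^ (1 - 1 / p)) ^ (p / (p - 1))) *
      (C + K * |x| ^ (1 - 1 / p)) ^ p * Real.exp (b * x)) (Iic T) := by
  have hp0 : 0 < p := by linarith
  have h1 : 1 / p < 1 := by rw [div_lt_one] <;> linarith
  set θ := 1 - 1 / p with hθ
  have hθ0 : 0 < θ := by linarith
  have hθ1 : θ ≤ 1 := by rw [hθ]; have : 0 < 1 / p := by positivity
                         linarith
  set q := p / (p - 1) with hq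
  have hq0 : 0 < q := div_pos hp0 (by linarith)
  have hθq : θ * q = 1 := by
    have : p - 1 ≠ 0 := by linarith
    rw [hθ, hq]; field_simp
  have hcy : Continuous fun x : ℝ => C + K * |x| ^ θ :=
    continuous_const.add (continuous_const.mul
      (Continuous.rpow_const continuous_abs fun _ => Or.inr hθ0.le))
  have hcont : Continuous fun x : ℝ => Real.exp (α * (C + K * |x| ^ θ) ^ q) *
      (C + K * |x| ^ θ) ^ p * Real.exp (b * x) := by
    refine ((Real.continuous_exp.comp (continuous_const.mul (hcy.rpow_const fun _ =>
      Or.inr hq0.le))).mul (hcy.rpow_const fun _ => Or.inr hp0.le)).mul (by fun_prop)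
  suffices hneg : IntegrableOn (fun x : ℝ => Real.exp (α * (C + K * |x| ^ θ) ^ q) *
      (C + K * |x| ^ θ) ^ p * Real.exp (b * x)) (Iic 0) by
    refine (hneg.union (hcont.integrableOn_Icc (a := 0) (b := T))).mono_set fun x hx => ?_
    rcases le_total x 0 with h | h
    · exact Or.inl h
    · exact Or.inr ⟨h, hx⟩
  rw [integrableOn_Iic_iff_integrableOn_Iio, ← (Measure.measurePreserving_neg
    (volume : Measure ℝ)).integrableOn_comp_preimage (Homeomorph.neg ℝ).measurableEmbedding]
  simp only [neg_preimage, neg_Iio, neg_zero]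
  obtain ⟨δ, hδ, hδb⟩ : ∃ δ : ℝ, 0 < δ ∧ α * K ^ q + 3 * δ = b :=
    ⟨(b - α * K ^ q) / 3, by linarith, by ring⟩
  refine integrable_of_isBigO_exp_neg hδ (hcont.comp continuous_neg).continuousOn ?_
  have hrat : Tendsto (fun x : ℝ => α * (C * x ^ (-θ) + K) ^ q) atTop (𝓝 (α * K ^ q)) := by
    have h2 : Tendsto (fun x : ℝ => C * x ^ (-θ) + K) atTop (𝓝 K) := by
      simpa using ((tendsto_rpow_neg_atTop hθ0).const_mul C).add_const K
    exact (h2.rpow_const (Or.inr hq0.le)).const_mul α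
  have hev1 : ∀ᶠ x : ℝ in atTop, α * (C * x ^ (-θ) + K) ^ q < α * K ^ q + δ :=
    hrat.eventually (gt_mem_nhds (by linarith))
  have hev2 := (isLittleO_rpow_exp_pos_mul_atTop p hδ).bound (one_pos)
  refine Asymptotics.IsBigO.of_bound ((C + K) ^ p) ?_
  filter_upwards [hev1, hev2, eventually_ge_atTop 1] with x hx1 hx2 hx3
  have hx0 : 0 < x := by linarith
  have hy0 : 0 ≤ C + K * x ^ θ := by positivity
  simp only [Function.comp, abs_neg, abs_of_pos hx0, Real.norm_eq_abs, Real.abs_exp, one_mul,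
    abs_of_pos (Real.rpow_pos_of_pos hx0 p)] at hx2 ⊢
  rw [abs_of_nonneg (by positivity)]
  have e1 : α * (C + K * x ^ θ) ^ q ≤ (α * K ^ q + δ) * x := by
    have : C + K * x ^ θ = (C * x ^ (-θ) + K) * x ^ θ := by
      rw [add_mul, mul_assoc, ← Real.rpow_add hx0]; simp
    rw [this, Real.mul_rpow (by positivity) (by positivity), ← Real.rpow_mul hx0.le, hθq,
      Real.rpow_one, ← mul_assoc]
    exact mul_le_mul_of_nonneg_right hx1.le hx0.le
  have e2 : (C + K * x ^ θ) ^ p ≤ (C + K) ^ p * Real.exp (δ * x) := by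
    have h3 : x ^ θ ≤ x := by
      simpa using Real.rpow_le_rpow_of_exponent_le hx3 hθ1
    have h4 : C + K * x ^ θ ≤ (C + K) * x := by nlinarith
    calc _ ≤ ((C + K) * x) ^ p := Real.rpow_le_rpow hy0 h4 hp0.le
      _ = (C + K) ^ p * x ^ p := Real.mul_rpow (by positivity) hx0.le
      _ ≤ _ := by gcongr
  calc _ ≤ Real.exp ((α * K ^ q + δ) * x) * ((C + K) ^ p * Real.exp (δ * x)) *
        Real.exp (b * -x) := by gcongr
    _ = (C + K) ^ p * (Real.exp ((α * K ^ q + δ) * x) * Real.exp (δ * x) * Real.exp (b * -x)) := by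
        ring
    _ = (C + K) ^ p * Real.exp (-δ * x) := by
        rw [← Real.exp_add, ← Real.exp_add, ← hδb]; ring_nf

/-- The integrand `(exp (α |z|^(p/(p-1))) - κ) |z|^p e^{b x}` of `expFunctional`. -/
noncomputable def expDensity (p α κ b x z : ℝ) : ℝ :=
  (Real.exp (α * |z| ^ (p / (p - 1))) - κ) * |z| ^ p * Real.exp (b * x)

noncomputable def expFunctional (p α κ b : ℝ) (h : ℝ → ℝ) : ℝ≥0∞ :=
  ∫⁻ x, ENNReal.ofReal (expDensity p α κ b x (h x))

noncomputable def weightedNorm (p a : ℝ) (h : ℝ → ℝ) : ℝ≥0∞ :=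
  ∫⁻ x, ENNReal.ofReal (|h x| ^ p * Real.exp (a * x))

theorem continuous_expDensity {p : ℝ} (hp : 1 < p) (α κ b : ℝ) :
    Continuous fun y : ℝ × ℝ => expDensity p α κ b y.1 y.2 := by
  have hp0 : 0 < p := by linarith
  have hq0 : 0 < p / (p - 1) := div_pos hp0 (by linarith)
  unfold expDensity
  refine (((Real.continuous_exp.comp (continuous_const.mul (Continuous.rpow_const (by fun_prop)
    fun _ => Or.inr hq0.le))).sub continuous_const).mul (Continuous.rpow_const (by fun_prop)
    fun _ => Or.inr hp0.le)).mul (by fun_prop)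

theorem expDensity_nonneg {p α κ : ℝ} (hα : 0 < α) (hκ : κ ≤ 1) (b x z : ℝ) :
    0 ≤ expDensity p α κ b x z := by
  unfold expDensity
  have : 1 ≤ Real.exp (α * |z| ^ (p / (p - 1))) := Real.one_le_exp (by positivity)
  have h2 : 0 ≤ Real.exp (α * |z| ^ (p / (p - 1))) - κ := by linarith
  positivity

theorem expDensity_mono {p α κ : ℝ} (hp : 1 < p) (hα : 0 < α) (hκ0 : 0 ≤ κ) (b x : ℝ)
    {z M : ℝ} (hz : |z| ≤ M) :
    expDensity p α κ b x z ≤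
      Real.exp (α * M ^ (p / (p - 1))) * M ^ p * Real.exp (b * x) := by
  have hp0 : 0 < p := by linarith
  have hq0 : 0 < p / (p - 1) := div_pos hp0 (by linarith)
  have h1 : |z| ^ (p / (p - 1)) ≤ M ^ (p / (p - 1)) := Real.rpow_le_rpow (abs_nonneg _) hz hq0.le
  have h2 : |z| ^ p ≤ M ^ p := Real.rpow_le_rpow (abs_nonneg _) hz hp0.le
  have h3 : Real.exp (α * |z| ^ (p / (p - 1))) ≤ Real.exp (α * M ^ (p / (p - 1))) := by gcongr
  unfold expDensity
  gcongr
  linarith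

theorem expDensity_le_tail {p α κ a b C c : ℝ} (hp : 1 < p) (hα : 0 < α)
    (hκ : κ = 0 ∧ b < a ∨ κ = 1 ∧ b = a) (hC : 0 < C) (hc : 0 < c) :
    ∃ D δ : ℝ, 0 < δ ∧ ∀ T x z : ℝ, 0 ≤ T → T ≤ x → |z| ≤ C * Real.exp (-(c * x)) →
      expDensity p α κ b x z ≤ D * Real.exp (-(δ * T)) * (|z| ^ p * Real.exp (a * x)) := by
  have hp0 : 0 < p := by linarith
  have hq0 : 0 < p / (p - 1) := div_pos hp0 (by linarith)
  set q := p / (p - 1) with hq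
  have hyC (x z : ℝ) (hx : 0 ≤ x) (hz : |z| ≤ C * Real.exp (-(c * x))) :
      α * |z| ^ q ≤ α * C ^ q := by
    have : |z| ≤ C := hz.trans (mul_le_of_le_one_right hC.le
      (Real.exp_le_one_iff.2 (by nlinarith)))
    gcongr
  rcases hκ with ⟨rfl, hab⟩ | ⟨rfl, rfl⟩
  · refine ⟨Real.exp (α * C ^ q), a - b, by linarith, fun T x z hT hx hz => ?_⟩
    have h1 := Real.exp_le_exp.2 (hyC x z (hT.trans hx) hz)
    have h2 : Real.exp (b * x) ≤ Real.exp (-((a - b) * T)) * Real.exp (a * x) := by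
      rw [← Real.exp_add]
      exact Real.exp_le_exp.2 (by nlinarith)
    unfold expDensity
    rw [sub_zero, ← hq]
    calc _ ≤ Real.exp (α * C ^ q) * |z| ^ p * (Real.exp (-((a - b) * T)) * Real.exp (a * x)) := by
          gcongr
      _ = _ := by ring
  · refine ⟨α * C ^ q * Real.exp (α * C ^ q), c * q, by positivity, fun T x z hT hx hz => ?_⟩
    have h1 := Real.exp_le_exp.2 (hyC x z (hT.trans hx) hz)
    have h2 : α * |z| ^ q ≤ α * C ^ q * Real.exp (-(c * q * T)) := by
      have : |z| ^ q ≤ (C * Real.exp (-(c * x))) ^ q := Real.rpow_le_rpow (abs_nonneg _) hz hq0.le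
      rw [Real.mul_rpow hC.le (Real.exp_pos _).le, ← Real.exp_mul] at this
      have h3 : Real.exp (-(c * x) * q) ≤ Real.exp (-(c * q * T)) :=
        Real.exp_le_exp.2 (by nlinarith [mul_pos hc hq0])
      calc _ ≤ α * (C ^ q * Real.exp (-(c * x) * q)) := by gcongr
        _ ≤ α * (C ^ q * Real.exp (-(c * q * T))) := by gcongr
        _ = _ := by ring
    have h4 : Real.exp (α * |z| ^ q) - 1 ≤ (α * |z| ^ q) * Real.exp (α * |z| ^ q) := by
      have := Real.add_one_le_exp (-(α * |z| ^ q))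
      have h5 : Real.exp (-(α * |z| ^ q)) * Real.exp (α * |z| ^ q) = 1 := by
        rw [← Real.exp_add]; simp
      nlinarith [Real.exp_pos (α * |z| ^ q)]
    have h6 : Real.exp (α * |z| ^ q) - 1 ≤
        α * C ^ q * Real.exp (-(c * q * T)) * Real.exp (α * C ^ q) := h4.trans (by gcongr)
    unfold expDensity
    rw [← hq]
    calc _ ≤ α * C ^ q * Real.exp (-(c * q * T)) * Real.exp (α * C ^ q) * |z| ^ p *
          Real.exp (b * x) := by gcongr
      _ = _ := by ring

theorem exists_maximizer_of_weightedNorm_le_one {p α κ a b : ℝ} {E : ℝ≥0∞} (hp : 1 < p)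
    (hE' : E ≠ ⊤) (hα : 0 < α) (ha : 0 < a) (hκ : κ = 0 ∧ b < a ∨ κ = 1 ∧ b = a)
    (hb : α * (E.toReal ^ (1 / p)) ^ (p / (p - 1)) < b) :
    ∃ h, HasEnergyLE p E h ∧ weightedNorm p a h ≤ 1 ∧
      ∀ f, HasEnergyLE p E f → weightedNorm p a f ≤ 1 →
        expFunctional p α κ b f ≤ expFunctional p α κ b h := by
  have hp0 : 0 < p := by linarith
  have hκ0 : 0 ≤ κ := by rcases hκ with ⟨rfl, _⟩ | ⟨rfl, _⟩ <;> norm_num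
  have hκ1 : κ ≤ 1 := by rcases hκ with ⟨rfl, _⟩ | ⟨rfl, _⟩ <;> norm_num
  obtain ⟨C, c, hC, hc, hdecay⟩ := HasEnergyLE.exists_exp_decay hp hE' ha
  set S : Set ℝ≥0∞ := {y | ∃ f, HasEnergyLE p E f ∧ weightedNorm p a f ≤ 1 ∧
    expFunctional p α κ b f = y} with hS
  have hSne : S.Nonempty := by
    refine ⟨_, 0, ⟨0, measurable_zero, ?_, by simp⟩, ?_, rfl⟩
    · simp [hp0]
    · simp [weightedNorm, hp0.ne']
  obtain ⟨f, hf, hfB, hJlim, h, hh⟩ : ∃ f : ℕ → ℝ → ℝ, (∀ n, HasEnergyLE p E (f n)) ∧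
      (∀ n, weightedNorm p a (f n) ≤ 1) ∧
      Tendsto (fun n => expFunctional p α κ b (f n)) atTop (𝓝 (sSup S)) ∧
      ∃ h : ℝ → ℝ, ∀ x, Tendsto (fun n => f n x) atTop (𝓝 (h x)) := by
    obtain ⟨y, -, hy, hyS⟩ := exists_seq_tendsto_sSup hSne (OrderTop.bddAbove S)
    choose f0 hf0 hfB0 hfJ0 using hyS
    obtain ⟨φ, hφ, h, hh⟩ := HasEnergyLE.exists_subseq_tendsto hp hE' hf0
      (fun n => hdecay _ (hf0 n) (hfB0 n))
    exact ⟨fun n => f0 (φ n), fun n => hf0 _, fun n => hfB0 _,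
      (hy.comp hφ.tendsto_atTop).congr fun n => (hfJ0 (φ n)).symm, h, hh⟩
  have hfc (n) : Continuous (f n) := (hf n).continuous hp hE'
  have hhE : HasEnergyLE p E h := HasEnergyLE.of_tendsto hp hE' hf hh
  have hmB (n) : Measurable fun x => ENNReal.ofReal (|f n x| ^ p * Real.exp (a * x)) := by
    have := (hfc n).measurable
    fun_prop
  refine ⟨h, hhE, ?_, fun f' hf' hfB' => (le_sSup ⟨f', hf', hfB', rfl⟩ : _ ≤ sSup S).trans ?_⟩
  · calc weightedNorm p a h
        = ∫⁻ x, liminf (fun n => ENNReal.ofReal (|f n x| ^ p * Real.exp (a * x))) atTop := by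
          refine lintegral_congr fun x => (Tendsto.liminf_eq ?_).symm
          exact ENNReal.tendsto_ofReal ((((hh x).abs).rpow_const (Or.inr hp0.le)).mul_const _)
      _ ≤ liminf (fun n => weightedNorm p a (f n)) atTop := lintegral_liminf_le hmB
      _ ≤ liminf (fun _ : ℕ => (1 : ℝ≥0∞)) atTop := liminf_le_liminf (Eventually.of_forall hfB)
      _ = 1 := by simp
  obtain ⟨D, δ, hδ, htail⟩ := expDensity_le_tail (p := p) hp hα hκ hC hc
  set K := E.toReal ^ (1 / p) with hK
  have hbd (n) (x : ℝ) : |f n x| ≤ C + K * |x| ^ (1 - 1 / p) := by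
    have h1 := hdecay _ (hf n) (hfB n) 0
    have h2 := (hf n).abs_sub_le hp hE' 0 x
    rw [mul_zero, neg_zero, Real.exp_zero, mul_one] at h1
    rw [sub_zero] at h2
    have h3 := abs_sub_abs_le_abs_sub (f n x) (f n 0)
    linarith
  have hmJ (n) : Measurable fun x => ENNReal.ofReal (expDensity p α κ b x (f n x)) :=
    ((continuous_expDensity hp α κ b).comp (continuous_id.prodMk (hfc n))).measurable.ennreal_ofReal
  have hT (T : ℝ) (hT : 0 ≤ T) : sSup S ≤ expFunctional p α κ b h +
      ENNReal.ofReal (D * Real.exp (-(δ * T))) := by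
    have hdct : Tendsto (fun n => ∫⁻ x in Iic T, ENNReal.ofReal (expDensity p α κ b x (f n x)))
        atTop (𝓝 (∫⁻ x in Iic T, ENNReal.ofReal (expDensity p α κ b x (h x)))) := by
      refine tendsto_lintegral_of_dominated_convergence _ hmJ
        (fun n => Eventually.of_forall fun x => ENNReal.ofReal_le_ofReal
          (expDensity_mono hp hα hκ0 b x (hbd n x)))
        (integrableOn_exp_growth hp hC.le (by positivity) hb T).lintegral_lt_top.ne
        (Eventually.of_forall fun x => ENNReal.tendsto_ofReal ?_)
      have hc' : Continuous fun z => expDensity p α κ b x z :=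
        (continuous_expDensity hp α κ b).comp (Continuous.prodMk_right x)
      exact (hc'.tendsto (h x)).comp (hh x)
    have hle (n) : expFunctional p α κ b (f n) ≤
        (∫⁻ x in Iic T, ENNReal.ofReal (expDensity p α κ b x (f n x))) +
          ENNReal.ofReal (D * Real.exp (-(δ * T))) := by
      unfold expFunctional
      rw [← lintegral_add_compl _ (measurableSet_Iic (a := T))]
      gcongr
      calc _ ≤ ∫⁻ x in (Iic T)ᶜ, ENNReal.ofReal (D * Real.exp (-(δ * T))) *
            ENNReal.ofReal (|f n x| ^ p * Real.exp (a * x)) := by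
            refine setLIntegral_mono' measurableSet_Iic.compl fun x hx => ?_
            rw [← ENNReal.ofReal_mul' (by positivity)]
            exact ENNReal.ofReal_le_ofReal (htail T x _ hT (show T < x by simpa using hx).le
              (hdecay _ (hf n) (hfB n) x))
        _ ≤ ENNReal.ofReal (D * Real.exp (-(δ * T))) * weightedNorm p a (f n) := by
            rw [lintegral_const_mul _ (hmB n)]
            gcongr
            exact setLIntegral_le_lintegral _ _
        _ ≤ _ := mul_le_of_le_one_right' (hfB n)
    refine (le_of_tendsto_of_tendsto' hJlim (hdct.add_const _) hle).trans ?_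
    gcongr
    exact setLIntegral_le_lintegral _ _
  have hlim : Tendsto (fun T : ℝ => expFunctional p α κ b h +
      ENNReal.ofReal (D * Real.exp (-(δ * T)))) atTop (𝓝 (expFunctional p α κ b h)) := by
    have h1 : Tendsto (fun T : ℝ => D * Real.exp (-(δ * T))) atTop (𝓝 0) := by
      have : Tendsto (fun T : ℝ => Real.exp (-(δ * T))) atTop (𝓝 0) :=
        Real.tendsto_exp_neg_atTop_nhds_zero.comp (tendsto_id.const_mul_atTop hδ)
      simpa using this.const_mul D
    have := (ENNReal.tendsto_ofReal h1).const_add (expFunctional p α κ b h)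
    simpa using this
  exact ge_of_tendsto hlim ((eventually_ge_atTop 0).mono hT)

theorem lintegral_ofReal_pos_of_continuous {f : ℝ → ℝ} (hf : Continuous f) {x : ℝ} (hx : 0 < f x) :
    0 < ∫⁻ y, ENNReal.ofReal (f y) := by
  rw [lintegral_pos_iff_support hf.measurable.ennreal_ofReal]
  have : Function.support (fun y => ENNReal.ofReal (f y)) = {y | 0 < f y} := by
    ext y; simp
  rw [this]
  exact (isOpen_lt continuous_const hf).measure_pos _ ⟨x, hx⟩

theorem expFunctional_pos {p α κ b : ℝ} (hp : 1 < p) (hα : 0 < α) (hκ : κ ≤ 1) {h : ℝ → ℝ}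
    (hh : Continuous h) {x : ℝ} (hx : h x ≠ 0) : 0 < expFunctional p α κ b h := by
  refine lintegral_ofReal_pos_of_continuous
    ((continuous_expDensity hp α κ b).comp (continuous_id.prodMk hh)) (x := x) ?_
  have h1 : 1 < Real.exp (α * |h x| ^ (p / (p - 1))) :=
    Real.one_lt_exp_iff.2 (mul_pos hα (Real.rpow_pos_of_pos (abs_pos.2 hx) _))
  have h2 : 0 < Real.exp (α * |h x| ^ (p / (p - 1))) - κ := by linarith
  have h3 : 0 < |h x| ^ p := Real.rpow_pos_of_pos (abs_pos.2 hx) _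
  unfold expDensity
  positivity

theorem weightedNorm_pos {p : ℝ} (hp : 1 < p) (a : ℝ) {h : ℝ → ℝ}
    (hh : Continuous h) {x : ℝ} (hx : h x ≠ 0) : 0 < weightedNorm p a h := by
  have h3 : 0 < |h x| ^ p := Real.rpow_pos_of_pos (abs_pos.2 hx) _
  refine lintegral_ofReal_pos_of_continuous (x := x) ?_ (by positivity)
  exact (Continuous.rpow_const (by fun_prop) fun _ => Or.inr (by linarith)).mul (by fun_prop)

theorem exists_ne_zero_of_expFunctional_ne_zero {p α κ b : ℝ} (hp : 1 < p) {h : ℝ → ℝ}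
    (hJ : expFunctional p α κ b h ≠ 0) : ∃ x, h x ≠ 0 := by
  by_contra! h0
  exact hJ (by simp [expFunctional, expDensity, h0, (by linarith : p ≠ 0)])

theorem weightedNorm_comp_add (p a c : ℝ) (h : ℝ → ℝ) :
    weightedNorm p a (fun x => h (x + c)) =
      ENNReal.ofReal (Real.exp (-(a * c))) * weightedNorm p a h := by
  unfold weightedNorm
  rw [← lintegral_const_mul' _ _ ENNReal.ofReal_ne_top]
  conv_rhs => rw [← lintegral_add_right_eq_self _ c]
  refine lintegral_congr fun x => ?_
  rw [← ENNReal.ofReal_mul (Real.exp_pos _).le, mul_left_comm, ← Real.exp_add]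
  ring_nf

theorem expFunctional_comp_add (p α κ b c : ℝ) (h : ℝ → ℝ) :
    expFunctional p α κ b (fun x => h (x + c)) =
      ENNReal.ofReal (Real.exp (-(b * c))) * expFunctional p α κ b h := by
  unfold expFunctional expDensity
  rw [← lintegral_const_mul' _ _ ENNReal.ofReal_ne_top]
  conv_rhs => rw [← lintegral_add_right_eq_self _ c]
  refine lintegral_congr fun x => ?_
  rw [← ENNReal.ofReal_mul (Real.exp_pos _).le, mul_left_comm, ← Real.exp_add]
  ring_nf

theorem weightedNorm_const_mul (p a : ℝ) {l : ℝ} (hl : 0 ≤ l) (h : ℝ → ℝ) :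
    weightedNorm p a (fun x => l * h x) = ENNReal.ofReal (l ^ p) * weightedNorm p a h := by
  unfold weightedNorm
  rw [← lintegral_const_mul' _ _ ENNReal.ofReal_ne_top]
  refine lintegral_congr fun x => ?_
  rw [← ENNReal.ofReal_mul (by positivity), abs_mul, abs_of_nonneg hl,
    Real.mul_rpow hl (abs_nonneg _), mul_assoc]

theorem le_expFunctional_const_mul {p α κ : ℝ} (hp : 1 < p) (hα : 0 < α)
    (b : ℝ) {l : ℝ} (hl : 1 ≤ l) (h : ℝ → ℝ) :
    ENNReal.ofReal (l ^ p) * expFunctional p α κ b h ≤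
      expFunctional p α κ b (fun x => l * h x) := by
  have hq0 : 0 < p / (p - 1) := div_pos (by linarith) (by linarith)
  unfold expFunctional expDensity
  rw [← lintegral_const_mul' _ _ ENNReal.ofReal_ne_top]
  refine lintegral_mono fun x => ?_
  rw [← ENNReal.ofReal_mul (by positivity)]
  have hl0 : 0 ≤ l := by linarith
  have h1 : |h x| ^ (p / (p - 1)) ≤ |l * h x| ^ (p / (p - 1)) := by
    refine Real.rpow_le_rpow (abs_nonneg _) ?_ hq0.le
    rw [abs_mul, abs_of_nonneg hl0]
    exact le_mul_of_one_le_left (abs_nonneg _) hl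
  refine ENNReal.ofReal_le_ofReal ?_
  rw [show |l * h x| ^ p = l ^ p * |h x| ^ p by
    rw [abs_mul, abs_of_nonneg hl0, Real.mul_rpow hl0 (abs_nonneg _)]]
  calc _ = (Real.exp (α * |h x| ^ (p / (p - 1))) - κ) * (l ^ p * |h x| ^ p) * Real.exp (b * x) := by
        ring
    _ ≤ _ := by gcongr

theorem exists_energyLE_expFunctional_pos {p α κ a b : ℝ} {E : ℝ≥0∞} (hp : 1 < p)
    (hE : E ≠ 0) (hα : 0 < α) (hκ : κ ≤ 1) :
    ∃ f, HasEnergyLE p E f ∧ weightedNorm p a f ≤ 1 ∧ 0 < expFunctional p α κ b f := by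
  have hp0 : 0 < p := by linarith
  let φ : ContDiffBump (0 : ℝ) := ⟨1, 2, one_pos, one_lt_two⟩
  have hφ1 : ContDiff ℝ 1 φ := φ.contDiff
  have hφc : HasCompactSupport φ := φ.hasCompactSupport
  have hφ0 : φ 0 = 1 := φ.one_of_mem_closedBall (Metric.mem_closedBall_self zero_le_one)
  have hφd : Continuous (deriv φ) := hφ1.continuous_deriv le_rfl
  have hφ : Continuous φ := hφ1.continuous
  have hfin {F : ℝ → ℝ} (hF : Continuous F) (hFc : HasCompactSupport F) :
      ∫⁻ x, ENNReal.ofReal (F x) ≠ ⊤ :=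
    (hF.integrable_of_hasCompactSupport hFc).lintegral_lt_top.ne
  have h1 : ∫⁻ x, ‖deriv φ x‖ₑ ^ p ≠ ⊤ := by
    have := hfin (F := fun x => |deriv φ x| ^ p)
      (Continuous.rpow_const (by fun_prop) fun _ => Or.inr hp0.le)
      (hφc.deriv.comp_left (g := fun y => |y| ^ p) (by simp [hp0.ne']))
    simpa [Real.enorm_eq_ofReal_abs, ENNReal.ofReal_rpow_of_nonneg, hp0.le] using this
  have h2 : weightedNorm p a φ ≠ ⊤ := by
    refine hfin ?_ ?_
    · exact (Continuous.rpow_const (by fun_prop) fun _ => Or.inr hp0.le).mul (by fun_prop)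
    · exact (hφc.comp_left (g := fun y => |y| ^ p) (by simp [hp0.ne'])).mul_right
  set M := (∫⁻ x, ‖deriv φ x‖ₑ ^ p) + weightedNorm p a φ + 1 with hM
  have hM' : M ≠ ⊤ := by simp [hM, h1, h2]
  have hM0 : M ≠ 0 := by simp [hM]
  set m := min E 1 / M with hm
  have hm' : m ≠ ⊤ := ENNReal.div_ne_top (by simp) hM0
  have hm0 : m ≠ 0 := by simp [hm, ENNReal.div_eq_zero_iff, hE, hM']
  have hmM : m * M = min E 1 := ENNReal.div_mul_cancel hM0 hM'
  set ε := m.toReal ^ (1 / p) with hε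
  have hε0 : 0 < ε := Real.rpow_pos_of_pos (ENNReal.toReal_pos hm0 hm') _
  have hεp : ENNReal.ofReal (ε ^ p) = m := by
    rw [hε, ← Real.rpow_mul (by positivity), one_div_mul_cancel hp0.ne', Real.rpow_one,
      ENNReal.ofReal_toReal hm']
  refine ⟨fun x => ε * φ x, ⟨fun x => ε * deriv φ x, by fun_prop, ?_, fun x y => ?_⟩, ?_,
    expFunctional_pos hp hα hκ (by fun_prop) (x := 0) (by simp [hφ0, hε0.ne'])⟩
  · simp_rw [enorm_mul, ENNReal.mul_rpow_of_nonneg _ _ hp0.le]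
    rw [lintegral_const_mul' _ _ (by simp [hp0.le]), Real.enorm_eq_ofReal hε0.le,
      ENNReal.ofReal_rpow_of_nonneg hε0.le hp0.le, hεp]
    calc _ ≤ m * M := by gcongr; rw [hM, add_assoc]; exact le_self_add
      _ ≤ E := by rw [hmM]; exact min_le_left _ _
  · rw [intervalIntegral.integral_const_mul, intervalIntegral.integral_deriv_eq_sub
      (fun z _ => (hφ1.differentiable one_ne_zero) z) (hφd.intervalIntegrable _ _)]
    ring
  · rw [weightedNorm_const_mul _ _ hε0.le, hεp]
    calc _ ≤ m * M := by gcongr; rw [hM, add_right_comm]; exact le_add_self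
      _ ≤ 1 := by rw [hmM]; exact min_le_right _ _

theorem expFunctional_le_mul_rpow {p α κ a b : ℝ} {E S : ℝ≥0∞} (ha : 0 < a) 
    (hS : ∀ f, HasEnergyLE p E f → weightedNorm p a f ≤ 1 → expFunctional p α κ b f ≤ S)
    {f : ℝ → ℝ} (hf : HasEnergyLE p E f) (hB0 : weightedNorm p a f ≠ 0)
    (hB : weightedNorm p a f ≠ ⊤) :
    expFunctional p α κ b f / weightedNorm p a f ^ (b / a) ≤ S := by
  set B := weightedNorm p a f with hBdef
  have hBr : 0 < B.toReal := ENNReal.toReal_pos hB0 hB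
  set c := Real.log B.toReal / a with hc
  have e1 : Real.exp (-(a * c)) = B.toReal⁻¹ := by
    rw [hc, mul_div_cancel₀ _ ha.ne', Real.exp_neg, Real.exp_log hBr]
  have e2 : ENNReal.ofReal (Real.exp (-(b * c))) = (B ^ (b / a))⁻¹ := by
    rw [show -(b * c) = -(Real.log B.toReal * (b / a)) by rw [hc]; ring, Real.exp_neg,
      ← Real.rpow_def_of_pos hBr, ENNReal.ofReal_inv_of_pos (by positivity),
      ← ENNReal.ofReal_rpow_of_pos hBr, ENNReal.ofReal_toReal hB]
  have h1 := hS _ (hf.comp_add c) (by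
    rw [weightedNorm_comp_add, e1, ENNReal.ofReal_inv_of_pos hBr, ENNReal.ofReal_toReal hB,
      ENNReal.inv_mul_cancel hB0 hB])
  rwa [expFunctional_comp_add, e2, mul_comm, ← div_eq_mul_inv] at h1

theorem expFunctional_zero_div {p α κ a b : ℝ} (hp : 1 < p) (hα : 0 < α) (ha : 0 < a)
    (hκ : κ = 0 ∧ b < a ∨ κ = 1 ∧ b = a) {f : ℝ → ℝ} (hf : Continuous f)
    (hB0 : weightedNorm p a f ≠ 0) (hB : weightedNorm p a f ≠ ⊤) :
    expFunctional p α 0 b f / weightedNorm p a f ^ (b / a) =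
      ENNReal.ofReal κ + expFunctional p α κ b f / weightedNorm p a f ^ (b / a) := by
  rcases hκ with ⟨rfl, -⟩ | ⟨rfl, rfl⟩
  · simp
  · have h1 : expFunctional p α 0 b f = weightedNorm p b f + expFunctional p α 1 b f := by
      unfold weightedNorm expFunctional
      rw [← lintegral_add_left]
      · refine lintegral_congr fun x => ?_
        rw [← ENNReal.ofReal_add (by positivity) (expDensity_nonneg hα le_rfl _ _ _)]
        unfold expDensity
        ring_nf
      · have : Continuous fun x => |f x| ^ p * Real.exp (b * x) :=
          (Continuous.rpow_const (by fun_prop) fun _ => Or.inr (by linarith)).mul (by fun_prop)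
        exact this.measurable.ennreal_ofReal
    rw [h1, div_self ha.ne', ENNReal.rpow_one, ENNReal.add_div, ENNReal.div_self hB0 hB,
      ENNReal.ofReal_one]

theorem weightedNorm_const {p a c : ℝ} (ha : 0 < a) (hc : c ≠ 0) :
    weightedNorm p a (fun _ => c) = ⊤ := by
  rw [eq_top_iff]
  have h3 : 0 < |c| ^ p := Real.rpow_pos_of_pos (abs_pos.2 hc) _
  calc ⊤ = ∫⁻ x in Ici (0 : ℝ), ENNReal.ofReal (|c| ^ p) := by
        rw [setLIntegral_const, Real.volume_Ici, ENNReal.mul_top (by simpa using h3)]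
    _ ≤ ∫⁻ x in Ici (0 : ℝ), ENNReal.ofReal (|c| ^ p * Real.exp (a * x)) := by
        refine setLIntegral_mono' measurableSet_Ici fun x hx => ENNReal.ofReal_le_ofReal ?_
        have hx' : 0 ≤ x := hx
        exact le_mul_of_one_le_right h3.le (Real.one_le_exp (by positivity))
    _ ≤ _ := setLIntegral_le_lintegral _ _

/-- The one-dimensional variational problem has a maximizer. -/
theorem exists_maximizer_expFunctional {p α a b : ℝ} {E : ℝ≥0∞} (hp : 1 < p) (hE : E ≠ 0)
    (hE' : E ≠ ⊤) (hα : 0 < α) (ha : 0 < a) (hba : b ≤ a)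
    (hb : α * (E.toReal ^ (1 / p)) ^ (p / (p - 1)) < b) :
    ∃ h G : ℝ → ℝ, Measurable G ∧ ∫⁻ x, ‖G x‖ₑ ^ p = E ∧
      (∀ x y, h y - h x = ∫ z in x..y, G z) ∧ weightedNorm p a h ≠ ⊤ ∧
      ∀ f, HasEnergyLE p E f → weightedNorm p a f ≠ ⊤ →
        expFunctional p α 0 b f / weightedNorm p a f ^ (b / a) ≤
          expFunctional p α 0 b h / weightedNorm p a h ^ (b / a) := by
  have hp0 : 0 < p := by linarith
  have hq0 : 0 < p / (p - 1) := div_pos hp0 (by linarith)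
  have hb0 : 0 < b := lt_of_le_of_lt (by positivity) hb
  obtain ⟨κ, hκ⟩ : ∃ κ : ℝ, κ = 0 ∧ b < a ∨ κ = 1 ∧ b = a := by
    rcases hba.lt_or_eq with h | h
    · exact ⟨0, Or.inl ⟨rfl, h⟩⟩
    · exact ⟨1, Or.inr ⟨rfl, h⟩⟩
  have hκ1 : κ ≤ 1 := by rcases hκ with ⟨rfl, _⟩ | ⟨rfl, _⟩ <;> norm_num
  obtain ⟨h, hh, hB1, hmax⟩ := exists_maximizer_of_weightedNorm_le_one hp hE' hα ha hκ hb
  obtain ⟨f₀, hf₀, hfB₀, hfJ₀⟩ := exists_energyLE_expFunctional_pos (a := a) (b := b) hp hE hα hκ1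
  have hJ : 0 < expFunctional p α κ b h := hfJ₀.trans_le (hmax _ hf₀ hfB₀)
  have hcont := hh.continuous hp hE'
  obtain ⟨x₀, hx₀⟩ := exists_ne_zero_of_expFunctional_ne_zero hp hJ.ne'
  have hB0 : weightedNorm p a h ≠ 0 := (weightedNorm_pos hp a hcont hx₀).ne'
  have hBt : weightedNorm p a h ≠ ⊤ := ne_top_of_le_ne_top ENNReal.one_ne_top hB1
  obtain ⟨G, hG, hGE, hd⟩ := hh
  set e := ∫⁻ x, ‖G x‖ₑ ^ p with he
  have he0 : e ≠ 0 := by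
    intro h0
    rw [he, lintegral_eq_zero_iff (hG.enorm.pow_const p)] at h0
    have hG0 : G =ᵐ[volume] 0 := by
      filter_upwards [h0] with x hx
      simpa [hp0, hp0.not_gt] using hx
    have hconst : h = fun _ => h x₀ := by
      ext y
      have := hd x₀ y
      rw [intervalIntegral.integral_zero_ae (hG0.mono fun x hx _ => hx)] at this
      linarith
    rw [hconst] at hBt
    exact hBt (weightedNorm_const ha hx₀)
  have he' : e ≠ ⊤ := ne_top_of_le_ne_top hE' hGE
  have hEe : E / e ≠ ⊤ := ENNReal.div_ne_top hE' he0
  have hEe1 : 1 ≤ E / e := by rwa [ENNReal.le_div_iff_mul_le (Or.inl he0) (Or.inl he'), one_mul]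
  have hEr : 1 ≤ (E / e).toReal := by
    rw [← ENNReal.toReal_one]; exact ENNReal.toReal_mono hEe hEe1
  set l := (E / e).toReal ^ (1 / p) with hl
  have hl1 : 1 ≤ l := Real.one_le_rpow hEr (by positivity)
  have hl0 : 0 ≤ l := by linarith
  have hlp : ENNReal.ofReal (l ^ p) = E / e := by
    rw [hl, ← Real.rpow_mul (by positivity), one_div_mul_cancel hp0.ne', Real.rpow_one,
      ENNReal.ofReal_toReal hEe]
  have hB' : weightedNorm p a (fun x => l * h x) = E / e * weightedNorm p a h := by
    rw [weightedNorm_const_mul _ _ hl0, hlp]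
  have hEe0 : E / e ≠ 0 := (zero_lt_one.trans_le hEe1).ne'
  have hB'0 : weightedNorm p a (fun x => l * h x) ≠ 0 := by rw [hB']; exact mul_ne_zero hEe0 hB0
  have hB't : weightedNorm p a (fun x => l * h x) ≠ ⊤ := by
    rw [hB']; exact ENNReal.mul_ne_top hEe hBt
  refine ⟨fun x => l * h x, fun x => l * G x, by fun_prop, ?_, fun x y => ?_, hB't,
    fun f hf hfB => ?_⟩
  · simp_rw [enorm_mul, ENNReal.mul_rpow_of_nonneg _ _ hp0.le]
    rw [lintegral_const_mul' _ _ (by simp [hp0.le]), Real.enorm_eq_ofReal hl0,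
      ENNReal.ofReal_rpow_of_nonneg hl0 hp0.le, hlp, ← he, ENNReal.div_mul_cancel he0 he']
  · rw [intervalIntegral.integral_const_mul, ← hd]
    ring
  · by_cases hf0 : ∃ x, f x ≠ 0
    · obtain ⟨x, hx⟩ := hf0
      have hfc := hf.continuous hp hE'
      have hfB0 := (weightedNorm_pos hp a hfc hx).ne'
      rw [expFunctional_zero_div hp hα ha hκ hfc hfB0 hfB,
        expFunctional_zero_div hp hα ha hκ (by fun_prop) hB'0 hB't]
      gcongr ENNReal.ofReal κ + ?_
      refine (expFunctional_le_mul_rpow ha hmax hf hfB0 hfB).trans ?_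
      rw [ENNReal.le_div_iff_mul_le (Or.inl ?_) (Or.inl ?_), hB']
      · calc expFunctional p α κ b h * (E / e * weightedNorm p a h) ^ (b / a)
            ≤ expFunctional p α κ b h * (E / e * 1) ^ (b / a) := by gcongr
          _ ≤ expFunctional p α κ b h * (E / e) := by
              rw [mul_one]
              gcongr
              refine (ENNReal.rpow_le_rpow_of_exponent_le hEe1 ((div_le_one ha).2 hba)).trans ?_
              rw [ENNReal.rpow_one]
          _ ≤ _ := by
              rw [mul_comm, ← hlp]
              exact le_expFunctional_const_mul hp hα b hl1 h
      · simp [hB'0, hB't]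
      · exact ENNReal.rpow_ne_top_of_nonneg (by positivity) hB't
    · push Not at hf0
      have : expFunctional p α 0 b f = 0 := by
        simp [expFunctional, expDensity, hf0, hp0.ne']
      simp [this]

/-- The measure `e^{n τ} dτ`. -/
noncomputable def expMeasure (n : ℕ) : Measure ℝ :=
  volume.withDensity fun τ => ENNReal.ofReal (Real.exp (n * τ))

theorem lintegral_expMeasure (n : ℕ) (f : ℝ → ℝ≥0∞) :
    ∫⁻ τ, f τ ∂expMeasure n = ∫⁻ τ, ENNReal.ofReal (Real.exp (n * τ)) * f τ := by
  rw [expMeasure, lintegral_withDensity_eq_lintegral_mul_non_measurable _ (by fun_prop)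
    (Eventually.of_forall fun _ => ENNReal.ofReal_lt_top)]
  rfl

instance (n : ℕ) : SigmaFinite (expMeasure n) :=
  SigmaFinite.withDensity_of_ne_top (Eventually.of_forall fun _ => ENNReal.ofReal_ne_top)

theorem expMeasure_absolutelyContinuous (n : ℕ) : expMeasure n ≪ volume :=
  withDensity_absolutelyContinuous _ _

noncomputable def expIoi (τ : ℝ) : Ioi (0 : ℝ) := ⟨Real.exp τ, Real.exp_pos τ⟩

theorem measurable_expIoi : Measurable expIoi := Real.measurable_exp.subtype_mk

theorem measurePreserving_expIoi (n : ℕ) :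
    MeasurePreserving expIoi (expMeasure (n + 1)) (Measure.volumeIoiPow n) := by
  refine ⟨measurable_expIoi, Measure.ext fun s hs => ?_⟩
  have himg : (Subtype.val '' s : Set ℝ) = Real.exp '' (expIoi ⁻¹' s) := by
    ext r
    constructor
    · rintro ⟨⟨y, hy⟩, hys, rfl⟩
      have hy' : 0 < y := hy
      refine ⟨Real.log y, ?_, Real.exp_log hy'⟩
      simpa [expIoi, Real.exp_log hy'] using hys
    · rintro ⟨τ, hτ, rfl⟩
      exact ⟨_, hτ, rfl⟩
  rw [Measure.map_apply measurable_expIoi hs, expMeasure,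
    withDensity_apply _ (measurable_expIoi hs), Measure.volumeIoiPow, withDensity_apply _ hs,
    setLIntegral_subtype measurableSet_Ioi _ fun a : ℝ ↦ ENNReal.ofReal (a ^ n), himg,
    lintegral_image_eq_lintegral_abs_deriv_mul (measurable_expIoi hs)
      (fun x _ => (Real.hasDerivAt_exp x).hasDerivWithinAt) Real.exp_injective.injOn]
  refine lintegral_congr fun τ => ?_
  rw [← ENNReal.ofReal_mul (abs_nonneg _), Real.abs_exp, ← Real.exp_nat_mul, ← Real.exp_add]
  push_cast
  ring_nf

section LogPolar

variable {V : Type*} [NormedAddCommGroup V] [NormedSpace ℝ V]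

/-- Logarithmic polar coordinates `(ω, τ) ↦ e^τ ω`. -/
noncomputable def logPolar (z : Metric.sphere (0 : V) 1 × ℝ) : V := Real.exp z.2 • (z.1 : V)

theorem norm_logPolar (z : Metric.sphere (0 : V) 1 × ℝ) : ‖logPolar z‖ = Real.exp z.2 := by
  simp [logPolar, norm_smul]

theorem log_norm_logPolar (z : Metric.sphere (0 : V) 1 × ℝ) : Real.log ‖logPolar z‖ = z.2 := by
  rw [norm_logPolar, Real.log_exp]

theorem continuous_logPolar : Continuous (logPolar (V := V)) := by
  unfold logPolar; fun_prop

variable [FiniteDimensional ℝ V] [Nontrivial V] [MeasurableSpace V] [BorelSpace V]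
  (μ : Measure V) [μ.IsAddHaarMeasure]

theorem measurePreserving_logPolar :
    MeasurePreserving (logPolar (V := V))
      (μ.toSphere.prod (expMeasure (Module.finrank ℝ V))) μ := by
  have hn : Module.finrank ℝ V - 1 + 1 = Module.finrank ℝ V :=
    Nat.sub_add_cancel Module.finrank_pos
  have h1 := (MeasurePreserving.id μ.toSphere).prod
    (measurePreserving_expIoi (Module.finrank ℝ V - 1))
  rw [hn] at h1
  have h2 := MeasurePreserving.symm (homeomorphUnitSphereProd V).toMeasurableEquiv
    μ.measurePreserving_homeomorphUnitSphereProd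
  have h3 : MeasurePreserving (Subtype.val : ({0}ᶜ : Set V) → V) (μ.comap Subtype.val) μ := by
    refine ⟨measurable_subtype_coe, ?_⟩
    rw [map_comap_subtype_coe (measurableSet_singleton 0).compl]
    exact Measure.restrict_eq_self_of_ae_mem (by simp [ae_iff])
  exact h3.comp (h2.comp h1)

theorem lintegral_fun_log_norm {F : ℝ → ℝ≥0∞} (hF : Measurable F) :
    ∫⁻ x, F (Real.log ‖x‖) ∂μ = μ.toSphere univ *
      ∫⁻ τ, ENNReal.ofReal (Real.exp (Module.finrank ℝ V * τ)) * F τ := by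
  rw [← (measurePreserving_logPolar μ).lintegral_comp
    (f := fun x => F (Real.log ‖x‖)) (hF.comp (by fun_prop))]
  simp_rw [log_norm_logPolar]
  rw [lintegral_prod _ (by fun_prop)]
  simp [lintegral_expMeasure, mul_comm]

theorem quasiMeasurePreserving_log_norm :
    Measure.QuasiMeasurePreserving (fun x : V => Real.log ‖x‖) μ volume := by
  have hm : Measurable fun x : V => Real.log ‖x‖ := by fun_prop
  refine ⟨hm, Measure.AbsolutelyContinuous.mk fun s hs hs0 => ?_⟩
  rw [Measure.map_apply hm hs, ← (measurePreserving_logPolar μ).measure_preimage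
    (hm hs).nullMeasurableSet, ← preimage_comp]
  have : ((fun x : V => Real.log ‖x‖) ∘ logPolar) = Prod.snd := funext log_norm_logPolar
  rw [this]
  exact Measure.quasiMeasurePreserving_snd.preimage_null (expMeasure_absolutelyContinuous _ hs0)

theorem ae_log_norm {P : ℝ → Prop} (hP : ∀ᵐ τ, P τ) : ∀ᵐ x ∂μ, P (Real.log ‖x‖) :=
  (quasiMeasurePreserving_log_norm μ).ae hP

end LogPolar

theorem exists_support_subset_Ioc {θ : ℝ → ℝ} (hθ : HasCompactSupport θ) :
    ∃ R : ℝ, 0 < R ∧ tsupport θ ⊆ Ioo (-R) R := by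
  obtain ⟨R, hR⟩ := hθ.isCompact.isBounded.subset_ball 0
  refine ⟨max R 1, by positivity, hR.trans ?_⟩
  rw [Real.ball_eq_Ioo, zero_sub, zero_add]
  exact Ioo_subset_Ioo (neg_le_neg (le_max_left _ _)) (le_max_left _ _)

theorem integral_primitive_mul_deriv {G h θ : ℝ → ℝ} (hG : LocallyIntegrable G volume)
    (hd : ∀ a b, h b - h a = ∫ x in a..b, G x) (hθ : ContDiff ℝ 1 θ) (hθc : HasCompactSupport θ) :
    ∫ x, h x * deriv θ x = -∫ x, G x * θ x := by
  obtain ⟨R, hR, hsub⟩ := exists_support_subset_Ioc hθc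
  have hGi (a b : ℝ) : IntervalIntegrable G volume a b :=
    (intervalIntegrable_iff' (by finiteness)).2 (hG.integrableOn_isCompact isCompact_uIcc)
  have hh : h = fun x => h (-R) + ∫ z in (-R)..x, G z := by
    ext x; rw [← hd]; ring
  have hac : AbsolutelyContinuousOnInterval h (-R) R := by
    have := (hGi (-R) R).absolutelyContinuousOnInterval_intervalIntegral (c := -R) left_mem_uIcc
    rw [hh]
    have hc : AbsolutelyContinuousOnInterval (fun _ : ℝ => h (-R)) (-R) R :=
      (LipschitzWith.const (h (-R))).lipschitzOnWith.absolutelyContinuousOnInterval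
    exact hc.add this
  have hθac : AbsolutelyContinuousOnInterval θ (-R) R := by
    obtain ⟨C, hC⟩ := hθ.lipschitzWith_of_hasCompactSupport hθc one_ne_zero
    exact hC.lipschitzOnWith.absolutelyContinuousOnInterval
  have hderiv : ∀ᵐ x, deriv h x = G x := by
    filter_upwards [_root_.LocallyIntegrable.ae_hasDerivAt_integral hG] with x hx
    have := (hx (-R)).const_add (h (-R))
    rw [← hh] at this
    exact this.deriv
  have hzero (x : ℝ) (hx : x ∉ Ioo (-R) R) : θ x = 0 := by
    by_contra h0
    exact hx (hsub (subset_tsupport _ h0))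
  have e1 : ∫ x in (-R)..R, h x * deriv θ x = ∫ x, h x * deriv θ x := by
    refine intervalIntegral.integral_eq_integral_of_support_subset fun x hx => ?_
    exact Ioo_subset_Ioc_self (hsub (support_deriv_subset (right_ne_zero_of_mul hx)))
  have e2 : ∫ x in (-R)..R, deriv h x * θ x = ∫ x, G x * θ x := by
    rw [← intervalIntegral.integral_eq_integral_of_support_subset (f := fun x => G x * θ x)
      (a := -R) (b := R) fun x hx =>
        Ioo_subset_Ioc_self (hsub (subset_tsupport _ (right_ne_zero_of_mul hx)))]
    exact intervalIntegral.integral_congr_ae (hderiv.mono fun x hx _ => by rw [hx])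
  rw [← e1, hac.integral_mul_deriv_eq_deriv_mul hθac, e2, hzero R (by simp), hzero (-R) (by simp)]
  ring

/-- The du Bois-Reymond lemma. -/
theorem ae_eq_const_of_integral_mul_deriv_eq_zero {w : ℝ → ℝ} (hw : LocallyIntegrable w volume)
    (h0 : ∀ θ : ℝ → ℝ, ContDiff ℝ (⊤ : ℕ∞) θ → HasCompactSupport θ → ∫ x, w x * deriv θ x = 0) :
    ∃ c : ℝ, ∀ᵐ x, w x = c := by
  let φ : ContDiffBump (0 : ℝ) := ⟨1, 2, one_pos, one_lt_two⟩
  set θ₀ : ℝ → ℝ := φ.normed volume with hθ₀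
  have hθ₀s : ContDiff ℝ (⊤ : ℕ∞) θ₀ := φ.contDiff_normed
  have hθ₀c : HasCompactSupport θ₀ := φ.hasCompactSupport_normed
  have hθ₀1 : ∫ x, θ₀ x = 1 := φ.integral_normed
  refine ⟨∫ x, w x * θ₀ x, ?_⟩
  set c := ∫ x, w x * θ₀ x with hc
  suffices ∀ᵐ x, w x - c = 0 by filter_upwards [this] with x hx; linarith
  refine ae_eq_zero_of_integral_contDiff_smul_eq_zero (hw.sub (locallyIntegrable_const c))
    fun θ hθ hθc => ?_
  set I := ∫ x, θ x with hI
  have hθi : Integrable θ := hθ.continuous.integrable_of_hasCompactSupport hθc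
  have hθ₀i : Integrable θ₀ := hθ₀s.continuous.integrable_of_hasCompactSupport hθ₀c
  set ψ : ℝ → ℝ := fun x => θ x - I * θ₀ x with hψ
  have hψs : ContDiff ℝ (⊤ : ℕ∞) ψ := hθ.sub (contDiff_const.mul hθ₀s)
  have hψc : HasCompactSupport ψ := hθc.sub hθ₀c.mul_left
  have hψ0 : ∫ x, ψ x = 0 := by
    rw [hψ, integral_sub hθi (hθ₀i.const_mul I), integral_const_mul, hθ₀1, mul_one, sub_self]
  obtain ⟨R, hR, hsub⟩ := exists_support_subset_Ioc hψc
  have hsupp : Function.support ψ ⊆ Ioc (-R) R :=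
    (subset_tsupport _).trans (hsub.trans Ioo_subset_Ioc_self)
  have hz (x : ℝ) (hx : x ∉ Ioo (-R) R) : ψ x = 0 := by
    by_contra h0
    exact hx (hsub (subset_tsupport _ h0))
  set η : ℝ → ℝ := fun x => ∫ z in (-R)..x, ψ z with hη
  have hηd (x : ℝ) : HasDerivAt η (ψ x) x :=
    intervalIntegral.integral_hasDerivAt_right (hψs.continuous.intervalIntegrable _ _)
      (hψs.continuous.stronglyMeasurableAtFilter _ _) hψs.continuous.continuousAt
  have hηd' : deriv η = ψ := funext fun x => (hηd x).deriv
  have hηs : ContDiff ℝ (⊤ : ℕ∞) η := by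
    rw [contDiff_infty_iff_deriv]
    exact ⟨fun x => (hηd x).differentiableAt, by rw [hηd']; exact hψs⟩
  have hηc : HasCompactSupport η := by
    refine HasCompactSupport.intro (isCompact_Icc (a := -R) (b := R)) fun x hx => ?_
    rcases lt_or_ge x (-R) with h | h
    · refine (intervalIntegral.integral_congr fun z hz' => hz z fun hz2 => ?_).trans
        intervalIntegral.integral_zero
      rw [uIcc_of_ge h.le] at hz'
      linarith [hz'.2, hz2.1]
    · have hx' : R < x := by
        by_contra h2
        exact hx ⟨h, not_lt.1 h2⟩
      change ∫ z in (-R)..x, ψ z = 0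
      rw [intervalIntegral.integral_eq_integral_of_support_subset
        (hsupp.trans (Ioc_subset_Ioc_right hx'.le)), hψ0]
  have h1 := h0 η hηs hηc
  rw [hηd'] at h1
  have hwθ : Integrable fun x => w x * θ x := by
    simpa [mul_comm] using hw.integrable_smul_left_of_hasCompactSupport hθ.continuous hθc
  have hwθ₀ : Integrable fun x => w x * θ₀ x := by
    simpa [mul_comm] using hw.integrable_smul_left_of_hasCompactSupport hθ₀s.continuous hθ₀c
  have h2 : ∫ x, w x * ψ x = (∫ x, w x * θ x) - I * c := by
    rw [hc, ← integral_const_mul, ← integral_sub hwθ (hwθ₀.const_mul I)]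
    refine integral_congr_ae (Eventually.of_forall fun x => ?_)
    simp only [hψ]; ring
  have h3 : ∫ x, θ x • (w x - c) = (∫ x, w x * θ x) - I * c := by
    rw [hI, ← integral_mul_const, ← integral_sub hwθ (hθi.mul_const c)]
    refine integral_congr_ae (Eventually.of_forall fun x => ?_)
    simp only [smul_eq_mul]; ring
  change ∫ x, θ x • (w x - c) = 0
  rw [h3, ← h2, h1]

theorem hasFDerivAt_log_norm {V : Type*} [NormedAddCommGroup V] [InnerProductSpace ℝ V] {x : V}
    (hx : x ≠ 0) :
    HasFDerivAt (fun y : V => Real.log ‖y‖) ((‖x‖ ^ 2)⁻¹ • innerSL ℝ x) x := by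
  have hx' : ‖x‖ ^ 2 ≠ 0 := by positivity
  have h := ((hasStrictFDerivAt_norm_sq x).hasFDerivAt.log hx').const_mul (1 / 2 : ℝ)
  have e1 : (fun y : V => Real.log ‖y‖) = fun y => 1 / 2 * Real.log (‖y‖ ^ 2) := by
    ext y; rw [Real.log_pow]; push_cast; ring
  have e2 : (‖x‖ ^ 2)⁻¹ • innerSL ℝ x =
      (1 / 2 : ℝ) • (‖x‖ ^ 2)⁻¹ • (2 : ℕ) • innerSL ℝ x := by
    ext y; simp; ring
  rw [e1, e2]
  exact h

section TestField

variable {N : ℕ} {k : ℝ → ℝ}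

local notation "ℝᴺ" => EuclideanSpace ℝ (Fin N)

/-- The components `k(log |x|) x_i` of a radial test field. -/
noncomputable def radialField (k : ℝ → ℝ) (i : Fin N) (x : ℝᴺ) : ℝ := k (Real.log ‖x‖) * x i

theorem exists_radialField_eq_zero (hk : HasCompactSupport k) :
    ∃ r R : ℝ, 0 < r ∧ ∀ x : ℝᴺ, (‖x‖ < r ∨ R < ‖x‖) → ∀ i, radialField k i x = 0 := by
  obtain ⟨R, hR, hsub⟩ := exists_support_subset_Ioc hk
  have hz (τ : ℝ) (h : τ ∉ Ioo (-R) R) : k τ = 0 := by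
    by_contra h0
    exact h (hsub (subset_tsupport _ h0))
  refine ⟨Real.exp (-R), Real.exp R, Real.exp_pos _, fun x hx i => ?_⟩
  rcases eq_or_ne x 0 with rfl | h0
  · simp [radialField]
  have hp : 0 < ‖x‖ := norm_pos_iff.2 h0
  rw [radialField, hz, zero_mul]
  rintro ⟨h1, h2⟩
  rcases hx with hx | hx
  · exact absurd h1 (not_lt.2 ((Real.log_lt_iff_lt_exp hp).2 hx).le)
  · exact absurd h2 (not_lt.2 ((Real.lt_log_iff_exp_lt hp).2 hx).le)

theorem hasCompactSupport_radialField (hk : HasCompactSupport k) (i : Fin N) :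
    HasCompactSupport (radialField k i) := by
  obtain ⟨r, R, hr, h⟩ := exists_radialField_eq_zero (N := N) hk
  refine HasCompactSupport.intro (isCompact_closedBall (0 : ℝᴺ) R) fun x hx => h x (Or.inr ?_) i
  simpa using hx

theorem contDiff_radialField (hk : HasCompactSupport k) (hks : ContDiff ℝ (⊤ : ℕ∞) k)
    (i : Fin N) : ContDiff ℝ (⊤ : ℕ∞) (radialField k i) := by
  obtain ⟨r, R, hr, h⟩ := exists_radialField_eq_zero (N := N) hk
  rw [contDiff_iff_contDiffAt]
  intro x
  have hi : ContDiff ℝ (⊤ : ℕ∞) fun y : ℝᴺ => y i := (EuclideanSpace.proj i : ℝᴺ →L[ℝ] ℝ).contDiff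
  rcases eq_or_ne x 0 with rfl | h0
  · refine (contDiffAt_const (c := (0 : ℝ))).congr_of_eventuallyEq ?_
    filter_upwards [Metric.ball_mem_nhds (0 : ℝᴺ) hr] with y hy
    exact h y (Or.inl (by simpa using hy)) i
  · exact (hks.contDiffAt.comp x ((contDiffAt_norm ℝ h0).log (norm_ne_zero_iff.2 h0))).mul
      hi.contDiffAt

theorem sum_fderiv_radialField (hks : Differentiable ℝ k) {x : ℝᴺ} (hx : x ≠ 0) :
    ∑ i, fderiv ℝ (radialField k i) x (EuclideanSpace.single i 1) =
      deriv k (Real.log ‖x‖) + N * k (Real.log ‖x‖) := by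
  have hx' : ‖x‖ ^ 2 ≠ 0 := by positivity
  have hd (i : Fin N) : fderiv ℝ (radialField k i) x (EuclideanSpace.single i 1) =
      deriv k (Real.log ‖x‖) * (‖x‖ ^ 2)⁻¹ * x i ^ 2 + k (Real.log ‖x‖) := by
    have h1 : HasFDerivAt (fun y : ℝᴺ => k (Real.log ‖y‖)) _ x :=
      (hks (Real.log ‖x‖)).hasDerivAt.comp_hasFDerivAt x (hasFDerivAt_log_norm hx)
    have h2 : HasFDerivAt (fun y : ℝᴺ => y i) (EuclideanSpace.proj i : ℝᴺ →L[ℝ] ℝ) x :=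
      (EuclideanSpace.proj i : ℝᴺ →L[ℝ] ℝ).hasFDerivAt
    have h3 : HasFDerivAt (radialField k i) _ x := h1.mul h2
    rw [h3.fderiv]
    simp [EuclideanSpace.inner_single_right]
    ring
  simp_rw [hd, Finset.sum_add_distrib, ← Finset.mul_sum, ← EuclideanSpace.real_norm_sq_eq]
  simp [mul_assoc, inv_mul_cancel₀ hx']

theorem HasWeakGradient.integral_radial [NeZero N] {u : ℝᴺ → ℝ} {g : ℝᴺ → ℝᴺ} (hug : HasWeakGradient u g)
    (hk : HasCompactSupport k) (hks : ContDiff ℝ (⊤ : ℕ∞) k) :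
    Integrable (fun x => inner ℝ (g x) x * k (Real.log ‖x‖)) ∧
    ∫ x, u x * (deriv k (Real.log ‖x‖) + N * k (Real.log ‖x‖)) =
      -∫ x, inner ℝ (g x) x * k (Real.log ‖x‖) := by
  obtain ⟨hu, hg, hd⟩ := hug
  have hs (i : Fin N) := contDiff_radialField hk hks i
  have hc (i : Fin N) := hasCompactSupport_radialField hk i
  have e1 (x : ℝᴺ) : inner ℝ (g x) x * k (Real.log ‖x‖) = ∑ i, g x i * radialField k i x := by
    simp only [PiLp.inner_apply, Finset.sum_mul, radialField]
    exact Finset.sum_congr rfl fun i _ => by simp; ring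
  have i1 (i : Fin N) : Integrable fun x => g x i * radialField k i x := by
    have := (hg.integrable_smul_left_of_hasCompactSupport (hs i).continuous (hc i))
    have h2 := (EuclideanSpace.proj i : ℝᴺ →L[ℝ] ℝ).integrable_comp this
    refine h2.congr (Eventually.of_forall fun x => ?_)
    simp [mul_comm]
  have i2 (i : Fin N) : Integrable fun x =>
      u x * fderiv ℝ (radialField k i) x (EuclideanSpace.single i 1) := by
    have hcont : Continuous fun x => fderiv ℝ (radialField k i) x (EuclideanSpace.single i 1) :=
      ((hs i).continuous_fderiv (by simp)).clm_apply continuous_const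
    have := hu.integrable_smul_left_of_hasCompactSupport hcont ((hc i).fderiv_apply ℝ _)
    refine this.congr (Eventually.of_forall fun x => ?_)
    simp [mul_comm]
  refine ⟨by simp_rw [e1]; exact integrable_finsetSum _ fun i _ => i1 i, ?_⟩
  simp_rw [e1]
  rw [integral_finsetSum _ fun i _ => i1 i, ← Finset.sum_neg_distrib,
    ← Finset.sum_congr rfl fun i _ => hd _ (hs i) (hc i) i, ← integral_finsetSum _ fun i _ => i2 i]
  have h0 : ∀ᵐ x : ℝᴺ, x ≠ 0 := by simp [ae_iff]
  refine integral_congr_ae (h0.mono fun x hx => ?_)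
  simp only
  rw [← Finset.mul_sum, sum_fderiv_radialField (hks.differentiable (by simp)) hx]

end TestField

theorem integrable_expMeasure_iff (n : ℕ) {f : ℝ → ℝ} :
    Integrable f (expMeasure n) ↔ Integrable fun τ => Real.exp (n * τ) * f τ := by
  rw [expMeasure, integrable_withDensity_iff_integrable_smul' (by fun_prop)
    (Eventually.of_forall fun _ => ENNReal.ofReal_lt_top)]
  simp [ENNReal.toReal_ofReal (Real.exp_pos _).le]

theorem integral_expMeasure (n : ℕ) (f : ℝ → ℝ) :
    ∫ τ, f τ ∂expMeasure n = ∫ τ, Real.exp (n * τ) * f τ := by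
  rw [expMeasure, integral_withDensity_eq_integral_toReal_smul (by fun_prop)
    (Eventually.of_forall fun _ => ENNReal.ofReal_lt_top)]
  simp [ENNReal.toReal_ofReal (Real.exp_pos _).le]

section EuclideanRadial

variable {N : ℕ}

local notation "ℝᴺ" => EuclideanSpace ℝ (Fin N)

local notation "σ" => Measure.toSphere (volume : Measure (EuclideanSpace ℝ (Fin N)))

theorem measurePreserving_logPolar_euclidean [NeZero N] :
    MeasurePreserving (logPolar (V := ℝᴺ)) ((σ).prod (expMeasure N)) volume := by
  simpa using measurePreserving_logPolar (volume : Measure ℝᴺ)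

theorem toSphere_univ_ne_zero [NeZero N] : σ univ ≠ 0 := by
  rw [Measure.toSphere_apply_univ]
  have : volume (Metric.ball (0 : ℝᴺ) 1) ≠ 0 := (Metric.measure_ball_pos _ _ one_pos).ne'
  simp [this, NeZero.ne N]

theorem toSphere_real_univ_ne_zero [NeZero N] : (σ).real univ ≠ 0 :=
  ENNReal.toReal_ne_zero.2 ⟨toSphere_univ_ne_zero, measure_ne_top _ _⟩

theorem locallyIntegrable_of_radial [NeZero N] {u : ℝᴺ → ℝ} (hu : LocallyIntegrable u volume)
    {v : ℝ → ℝ} (hv : ∀ z, u (logPolar z) = v z.2) : LocallyIntegrable v volume := by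
  have h1 (R : ℝ) : IntegrableOn (fun τ => Real.exp (N * τ) * v τ) (Iic R) := by
    have h2 : Integrable ((Metric.closedBall (0 : ℝᴺ) (Real.exp R)).indicator u) :=
      (hu.integrableOn_isCompact (isCompact_closedBall _ _)).integrable_indicator
        measurableSet_closedBall
    have h3 := measurePreserving_logPolar_euclidean.integrable_comp_of_integrable h2
    have h4 : Integrable (fun z : _ × ℝ => (Iic R).indicator v z.2) ((σ).prod (expMeasure N)) := by
      refine h3.congr (Eventually.of_forall fun z => ?_)
      simp [indicator, norm_logPolar, hv]
    have h5 := (integrable_expMeasure_iff N).1 (h4.of_comp_snd (by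
      rw [ne_eq, ← Measure.measure_univ_eq_zero]; exact toSphere_univ_ne_zero))
    rw [← integrable_indicator_iff measurableSet_Iic]
    refine h5.congr (Eventually.of_forall fun τ => ?_)
    by_cases h : τ ∈ Iic R <;> simp [indicator, h]
  have h2 : LocallyIntegrable (fun τ => Real.exp (N * τ) * v τ) volume := fun x =>
    ⟨Iic (x + 1), Iic_mem_nhds (by linarith), h1 _⟩
  refine locallyIntegrable_iff.2 fun K hK => ?_
  refine ((h2.integrableOn_isCompact hK).continuousOn_mul
    (g := fun τ => Real.exp (-(N * τ))) (by fun_prop) hK).congr_fun (fun τ _ => ?_) hK.measurableSet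
  simp only [← mul_assoc, ← Real.exp_add]
  simp

/-- The spherical mean of the radial component of `g`, in logarithmic polar coordinates. -/
noncomputable def radialMean (g : ℝᴺ → ℝᴺ) (τ : ℝ) : ℝ :=
  ((σ).real univ)⁻¹ * ∫ z, inner ℝ (g (logPolar (z, τ))) (logPolar (z, τ)) ∂σ

theorem measurable_radialMean {g : ℝᴺ → ℝᴺ} (hg : Measurable g) : Measurable (radialMean g) := by
  have h1 : Measurable fun z : Metric.sphere (0 : ℝᴺ) 1 × ℝ =>
      inner ℝ (g (logPolar z)) (logPolar z) :=
    (hg.comp continuous_logPolar.measurable).inner continuous_logPolar.measurable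
  exact (h1.stronglyMeasurable.integral_prod_left' (μ := σ)).measurable.const_mul _

theorem lintegral_radialMean_rpow_le [NeZero N] (hN : 1 < N) {g : ℝᴺ → ℝᴺ} (hg : Measurable g) :
    ∫⁻ τ, ‖radialMean g τ‖ₑ ^ (N : ℝ) ≤ (σ univ)⁻¹ * ∫⁻ x, ‖g x‖ₑ ^ (N : ℝ) := by
  have hN' : (1 : ℝ) < N := by exact_mod_cast hN
  have hgl : Measurable fun z : Metric.sphere (0 : ℝᴺ) 1 × ℝ => g (logPolar z) :=
    hg.comp continuous_logPolar.measurable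
  have hω0 : σ univ ≠ 0 := toSphere_univ_ne_zero
  have hω1 : σ univ ≠ ⊤ := measure_ne_top _ _
  have h1 (τ : ℝ) : ‖radialMean g τ‖ₑ ^ (N : ℝ) ≤
      (σ univ)⁻¹ * (ENNReal.ofReal (Real.exp (N * τ)) *
        ∫⁻ z, ‖g (logPolar (z, τ))‖ₑ ^ (N : ℝ) ∂σ) := by
    set F : Metric.sphere (0 : ℝᴺ) 1 → ℝ≥0∞ := fun z => ‖g (logPolar (z, τ))‖ₑ with hF
    have hFm : Measurable F := (hgl.comp measurable_prodMk_right).enorm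
    have h2 : ‖radialMean g τ‖ₑ ≤ (σ univ)⁻¹ * (ENNReal.ofReal (Real.exp τ) * ∫⁻ z, F z ∂σ) := by
      rw [radialMean, enorm_mul, enorm_inv toSphere_real_univ_ne_zero,
        Real.enorm_of_nonneg measureReal_nonneg, Measure.real, ENNReal.ofReal_toReal hω1,
        ← lintegral_const_mul _ hFm]
      gcongr
      refine (enorm_integral_le_lintegral_enorm _).trans (lintegral_mono fun z => ?_)
      rw [← ofReal_norm, hF]
      simp only
      rw [← ofReal_norm, ← ENNReal.ofReal_mul (Real.exp_pos _).le, mul_comm]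
      refine ENNReal.ofReal_le_ofReal ((norm_inner_le_norm _ _).trans_eq ?_)
      rw [norm_logPolar]
    calc ‖radialMean g τ‖ₑ ^ (N : ℝ)
        ≤ ((σ univ)⁻¹ * (ENNReal.ofReal (Real.exp τ) *
          ((∫⁻ z, F z ^ (N : ℝ) ∂σ) ^ (1 / (N : ℝ)) * σ univ ^ (1 - 1 / (N : ℝ))))) ^ (N : ℝ) := by
          gcongr
          exact h2.trans (by gcongr; exact lintegral_le_rpow_mul_measure_univ hFm.aemeasurable hN')
      _ = (σ univ)⁻¹ ^ (N : ℝ) * (ENNReal.ofReal (Real.exp (N * τ)) *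
          ((∫⁻ z, F z ^ (N : ℝ) ∂σ) * σ univ ^ ((N : ℝ) - 1))) := by
          have hp : (0 : ℝ) ≤ N := by linarith
          rw [ENNReal.mul_rpow_of_nonneg _ _ hp, ENNReal.mul_rpow_of_nonneg _ _ hp,
            ENNReal.mul_rpow_of_nonneg _ _ hp, ← ENNReal.rpow_mul, ← ENNReal.rpow_mul,
            ENNReal.ofReal_rpow_of_pos (Real.exp_pos _), ← Real.exp_mul, one_div,
            inv_mul_cancel₀ (by linarith), ENNReal.rpow_one, sub_mul,
            inv_mul_cancel₀ (by linarith), one_mul, mul_comm τ]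
      _ = _ := by
          have : (σ univ)⁻¹ ^ (N : ℝ) * σ univ ^ ((N : ℝ) - 1) = (σ univ)⁻¹ := by
            rw [ENNReal.inv_rpow, ← ENNReal.rpow_neg, ← ENNReal.rpow_add _ _ hω0 hω1,
              ← ENNReal.rpow_neg_one]
            ring_nf
          calc _ = ((σ univ)⁻¹ ^ (N : ℝ) * σ univ ^ ((N : ℝ) - 1)) *
                (ENNReal.ofReal (Real.exp (N * τ)) * ∫⁻ z, F z ^ (N : ℝ) ∂σ) := by ring
            _ = _ := by rw [this]
  calc ∫⁻ τ, ‖radialMean g τ‖ₑ ^ (N : ℝ) ≤ ∫⁻ τ, (σ univ)⁻¹ *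
        (ENNReal.ofReal (Real.exp (N * τ)) * ∫⁻ z, ‖g (logPolar (z, τ))‖ₑ ^ (N : ℝ) ∂σ) :=
        lintegral_mono h1
    _ = _ := by
        rw [lintegral_const_mul' _ _ (by simpa using hω0),
          ← lintegral_expMeasure N fun τ => ∫⁻ z, ‖g (logPolar (z, τ))‖ₑ ^ (N : ℝ) ∂σ,
          ← lintegral_prod_symm (fun z => ‖g (logPolar z)‖ₑ ^ (N : ℝ))
            (hgl.enorm.pow_const _).aemeasurable,
          measurePreserving_logPolar_euclidean.lintegral_comp (f := fun x => ‖g x‖ₑ ^ (N : ℝ))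
            (hg.enorm.pow_const _)]

theorem integral_logPolar [NeZero N] {f : ℝᴺ → ℝ} (hf : AEStronglyMeasurable f volume) :
    ∫ x, f x = ∫ z, f (logPolar z) ∂(σ).prod (expMeasure N) := by
  have h := measurePreserving_logPolar_euclidean (N := N)
  rw [← h.map_eq] at hf ⊢
  rw [integral_map h.aemeasurable hf]
  exact congrArg (fun μ => ∫ z, f (logPolar z) ∂(Measure.toSphere μ).prod (expMeasure N)) h.map_eq.symm

theorem HasWeakGradient.integral_mul_deriv_of_radial [NeZero N] {u : ℝᴺ → ℝ} {g g' : ℝᴺ → ℝᴺ}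
    (hug : HasWeakGradient u g) (hgg' : g =ᵐ[volume] g') {v : ℝ → ℝ}
    (hv : ∀ z, u (logPolar z) = v z.2) {θ : ℝ → ℝ} (hθ : ContDiff ℝ (⊤ : ℕ∞) θ)
    (hθc : HasCompactSupport θ) :
    ∫ τ, v τ * deriv θ τ = -∫ τ, radialMean g' τ * θ τ := by
  set k : ℝ → ℝ := fun τ => θ τ * Real.exp (-(N * τ)) with hk
  have hks : ContDiff ℝ (⊤ : ℕ∞) k := hθ.mul (by fun_prop)
  have hkc : HasCompactSupport k := hθc.mul_right
  have hkd (τ : ℝ) : deriv k τ + N * k τ = deriv θ τ * Real.exp (-(N * τ)) := by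
    have h1 : HasDerivAt (fun τ : ℝ => Real.exp (-(N * τ))) _ τ :=
      ((hasDerivAt_id τ).const_mul (N : ℝ)).neg.exp
    have h2 : HasDerivAt k _ τ := ((hθ.differentiable (by simp)) τ).hasDerivAt.mul h1
    rw [h2.deriv]
    simp [hk]
    ring
  obtain ⟨hint, heq⟩ := hug.integral_radial hkc hks
  have hae : (fun x => inner ℝ (g x) x * k (Real.log ‖x‖)) =ᵐ[volume]
      fun x => inner ℝ (g' x) x * k (Real.log ‖x‖) := hgg'.mono fun x hx => by simp only [hx]
  rw [integral_congr_ae hae] at heq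
  replace hint := hint.congr hae
  have hL : ∫ x, u x * (deriv k (Real.log ‖x‖) + N * k (Real.log ‖x‖)) =
      (σ).real univ * ∫ τ, v τ * deriv θ τ := by
    have hm : Measurable fun x : ℝᴺ => deriv k (Real.log ‖x‖) + N * k (Real.log ‖x‖) :=
      ((measurable_deriv k).add (hks.continuous.measurable.const_mul _)).comp
        (Real.measurable_log.comp measurable_norm)
    refine (integral_logPolar
      (hug.1.aestronglyMeasurable.mul hm.aestronglyMeasurable)).trans ?_
    simp only [Pi.mul_apply]
    simp_rw [log_norm_logPolar, hv, hkd]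
    rw [integral_fun_snd (fun τ => v τ * (deriv θ τ * Real.exp (-(N * τ)))), integral_expMeasure,
      smul_eq_mul]
    congr 1
    refine integral_congr_ae (Eventually.of_forall fun τ => ?_)
    simp only
    rw [Real.exp_neg]
    field_simp
  have hR : ∫ x, inner ℝ (g' x) x * k (Real.log ‖x‖) =
      (σ).real univ * ∫ τ, radialMean g' τ * θ τ := by
    refine (integral_logPolar hint.aestronglyMeasurable).trans
      ((integral_prod_symm _
        (measurePreserving_logPolar_euclidean.integrable_comp_of_integrable hint)).trans ?_)
    rw [integral_expMeasure, ← integral_const_mul]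
    refine integral_congr_ae (Eventually.of_forall fun τ => ?_)
    simp only [Function.comp_apply, log_norm_logPolar]
    have := toSphere_real_univ_ne_zero (N := N)
    rw [integral_mul_const, radialMean]
    simp only [hk]
    rw [Real.exp_neg]
    field_simp
  rw [hL, hR, ← mul_neg] at heq
  exact mul_left_cancel₀ toSphere_real_univ_ne_zero heq

theorem HasWeakGradient.exists_hasEnergyLE (hN : 1 < N) {u : ℝᴺ → ℝ} {g : ℝᴺ → ℝᴺ}
    (hrad : ∀ x y, ‖x‖ = ‖y‖ → u x = u y) (hug : HasWeakGradient u g)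
    (hg : ∫⁻ x, ‖g x‖ₑ ^ (N : ℝ) ≠ ⊤) :
    ∃ h, HasEnergyLE N ((σ univ)⁻¹ * ∫⁻ x, ‖g x‖ₑ ^ (N : ℝ)) h ∧ ∀ᵐ x, u x = h (Real.log ‖x‖) := by
  have : NeZero N := ⟨by omega⟩
  have hN' : (1 : ℝ) < N := by exact_mod_cast hN
  obtain ⟨g', hg', hgg'⟩ : ∃ g', Measurable g' ∧ g =ᵐ[volume] g' :=
    ⟨_, (hug.2.1.aestronglyMeasurable.stronglyMeasurable_mk).measurable,
      hug.2.1.aestronglyMeasurable.ae_eq_mk⟩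
  have hgl : ∫⁻ x, ‖g x‖ₑ ^ (N : ℝ) = ∫⁻ x, ‖g' x‖ₑ ^ (N : ℝ) :=
    lintegral_congr_ae (hgg'.mono fun x hx => by simp only [hx])
  set E := (σ univ)⁻¹ * ∫⁻ x, ‖g x‖ₑ ^ (N : ℝ) with hE
  have hE' : E ≠ ⊤ := ENNReal.mul_ne_top (ENNReal.inv_ne_top.2 toSphere_univ_ne_zero) hg
  set e : ℝᴺ := EuclideanSpace.single 0 1 with he
  have hen : ‖e‖ = 1 := by simp [he]
  set v : ℝ → ℝ := fun τ => u (Real.exp τ • e) with hv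
  have huv (z : Metric.sphere (0 : ℝᴺ) 1 × ℝ) : u (logPolar z) = v z.2 :=
    hrad _ _ (by rw [norm_logPolar, norm_smul, hen]; simp)
  have hvl := locallyIntegrable_of_radial hug.1 huv
  set G := radialMean g' with hG
  have hGm : Measurable G := measurable_radialMean hg'
  have hGE : ∫⁻ τ, ‖G τ‖ₑ ^ (N : ℝ) ≤ E := by
    rw [hE, hgl]; exact lintegral_radialMean_rpow_le hN hg'
  have hGi := intervalIntegrable_of_lintegral_rpow hN' hE' hGm hGE
  have hGl : LocallyIntegrable G volume := fun x =>
    ⟨Ioc (x - 1) (x + 1), Ioc_mem_nhds (by linarith) (by linarith),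
      (intervalIntegrable_iff_integrableOn_Ioc_of_le (by linarith)).1 (hGi _ _)⟩
  set h : ℝ → ℝ := fun τ => ∫ z in (0 : ℝ)..τ, G z with hh
  have hd (a b : ℝ) : h b - h a = ∫ z in a..b, G z :=
    intervalIntegral.integral_interval_sub_left (hGi _ _) (hGi _ _)
  have hhE : HasEnergyLE N E h := ⟨G, hGm, hGE, hd⟩
  have hhl : LocallyIntegrable h volume := (hhE.continuous hN' hE').locallyIntegrable
  obtain ⟨c, hc⟩ := ae_eq_const_of_integral_mul_deriv_eq_zero (hvl.sub hhl) fun θ hθ hθc => by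
    have hdc : Continuous (deriv θ) := hθ.continuous_deriv (by simp)
    have i1 : Integrable fun τ => v τ * deriv θ τ := by
      simpa [mul_comm] using hvl.integrable_smul_left_of_hasCompactSupport hdc hθc.deriv
    have i2 : Integrable fun τ => h τ * deriv θ τ := by
      simpa [mul_comm] using hhl.integrable_smul_left_of_hasCompactSupport hdc hθc.deriv
    simp only [Pi.sub_apply, sub_mul]
    rw [integral_sub i1 i2, hug.integral_mul_deriv_of_radial hgg' huv hθ hθc,
      integral_primitive_mul_deriv hGl hd (hθ.of_le (by simp)) hθc, sub_self]
  refine ⟨fun τ => h τ + c, ⟨G, hGm, hGE, fun a b => by rw [← hd]; ring⟩, ?_⟩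
  have h0 : ∀ᵐ x : ℝᴺ, x ≠ 0 := by simp [ae_iff]
  filter_upwards [ae_log_norm volume hc, h0] with x hx hx0
  have hux : u x = v (Real.log ‖x‖) :=
    hrad _ _ (by rw [norm_smul, hen, Real.exp_log (norm_pos_iff.2 hx0)]; simp)
  simp only [Pi.sub_apply] at hx
  rw [hux]; linarith

theorem lintegral_log_norm [NeZero N] {F : ℝ → ℝ≥0∞} (hF : Measurable F) :
    ∫⁻ x : ℝᴺ, F (Real.log ‖x‖) = σ univ * ∫⁻ τ, ENNReal.ofReal (Real.exp (N * τ)) * F τ := by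
  simpa using lintegral_fun_log_norm (volume : Measure ℝᴺ) hF

theorem locallyIntegrable_one_add_abs_log_norm (hN : 1 < N) :
    LocallyIntegrable (fun x : ℝᴺ => 1 + |Real.log ‖x‖|) volume := by
  have : NeZero N := ⟨by omega⟩
  have hN' : (2 : ℝ) ≤ N := by exact_mod_cast hN
  have key (R : ℝ) (hR : 0 ≤ R) :
      IntegrableOn (fun x : ℝᴺ => 1 + |Real.log ‖x‖|) (Metric.ball 0 (Real.exp R)) := by
    have hm : Measurable fun x : ℝᴺ => 1 + |Real.log ‖x‖| := by
      simp_rw [← Real.norm_eq_abs]; fun_prop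
    refine ⟨hm.aestronglyMeasurable, ?_⟩
    have hF : Measurable fun τ : ℝ => (Iic R).indicator (fun τ => ‖1 + |τ|‖ₑ) τ :=
      Measurable.indicator (by fun_prop) measurableSet_Iic
    have h1 : ∫⁻ x in Metric.ball (0 : ℝᴺ) (Real.exp R), ‖1 + |Real.log ‖x‖|‖ₑ ≤
        ∫⁻ x : ℝᴺ, (Iic R).indicator (fun τ => ‖1 + |τ|‖ₑ) (Real.log ‖x‖) := by
      rw [← lintegral_indicator measurableSet_ball]
      refine lintegral_mono fun x => ?_
      by_cases hx : x ∈ Metric.ball (0 : ℝᴺ) (Real.exp R)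
      · rw [indicator_of_mem hx, indicator_of_mem]
        rcases eq_or_ne x 0 with rfl | h0
        · simpa using hR
        · rw [mem_ball_zero_iff] at hx
          exact ((Real.log_lt_iff_lt_exp (norm_pos_iff.2 h0)).2 hx).le
      · rw [indicator_of_notMem hx]; exact zero_le
    refine h1.trans_lt ?_
    rw [lintegral_log_norm hF]
    refine ENNReal.mul_lt_top (measure_lt_top _ _) ?_
    have hint : IntegrableOn (fun τ => Real.exp (N * R) * Real.exp τ) (Iic R) :=
      (integrableOn_exp_Iic R).const_mul _
    refine lt_of_le_of_lt ?_ hint.hasFiniteIntegral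
    rw [← lintegral_indicator measurableSet_Iic]
    refine lintegral_mono fun τ => ?_
    by_cases hτ : τ ∈ Iic R
    · rw [indicator_of_mem hτ, indicator_of_mem hτ, Real.enorm_of_nonneg (by positivity),
        Real.enorm_of_nonneg (by positivity), ← ENNReal.ofReal_mul (by positivity)]
      refine ENNReal.ofReal_le_ofReal ?_
      simp only
      rw [← Real.exp_add]
      have h2 : 1 + |τ| ≤ Real.exp |τ| := by linarith [Real.add_one_le_exp |τ|]
      calc Real.exp (N * τ) * (1 + |τ|) ≤ Real.exp (N * τ) * Real.exp |τ| := by gcongr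
        _ = Real.exp (N * τ + |τ|) := (Real.exp_add _ _).symm
        _ ≤ _ := Real.exp_le_exp.2 ?_
      rw [mem_Iic] at hτ
      rcases le_total 0 τ with h | h
      · rw [abs_of_nonneg h]; nlinarith
      · rw [abs_of_nonpos h]; nlinarith [mul_nonneg (by linarith : (0 : ℝ) ≤ N) hR]
    · simp [indicator_of_notMem hτ]
  intro x
  refine ⟨Metric.ball 0 (Real.exp ‖x‖), Metric.isOpen_ball.mem_nhds ?_, key _ (norm_nonneg x)⟩
  rw [mem_ball_zero_iff]
  linarith [Real.add_one_le_exp ‖x‖]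

/-- The gradient of `h(log |x|)` when `h' = G`. -/
noncomputable def radialGrad (G : ℝ → ℝ) (x : ℝᴺ) : ℝᴺ := (G (Real.log ‖x‖) * (‖x‖ ^ 2)⁻¹) • x

theorem measurable_radialGrad {G : ℝ → ℝ} (hG : Measurable G) :
    Measurable (radialGrad G : ℝᴺ → ℝᴺ) := by
  unfold radialGrad; fun_prop

theorem lintegral_radialGrad_rpow (hN : 1 < N) {G : ℝ → ℝ} (hG : Measurable G) :
    ∫⁻ x : ℝᴺ, ‖radialGrad G x‖ₑ ^ (N : ℝ) = σ univ * ∫⁻ τ, ‖G τ‖ₑ ^ (N : ℝ) := by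
  have : NeZero N := ⟨by omega⟩
  have hF : Measurable fun τ => ‖G τ‖ₑ ^ (N : ℝ) * ENNReal.ofReal (Real.exp (-(N * τ))) := by
    fun_prop
  have h0 : ∀ᵐ x : ℝᴺ, x ≠ 0 := by simp [ae_iff]
  have h1 : ∫⁻ x : ℝᴺ, ‖radialGrad G x‖ₑ ^ (N : ℝ) = ∫⁻ x : ℝᴺ, ‖G (Real.log ‖x‖)‖ₑ ^ (N : ℝ) *
      ENNReal.ofReal (Real.exp (-(N * Real.log ‖x‖))) := by
    refine lintegral_congr_ae (h0.mono fun x hx => ?_)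
    have hp : 0 < ‖x‖ := norm_pos_iff.2 hx
    have e1 : ‖(‖x‖ ^ 2)⁻¹ • x‖ = Real.exp (-Real.log ‖x‖) := by
      rw [norm_smul, Real.exp_neg, Real.exp_log hp, norm_inv, norm_pow, norm_norm]
      field_simp
    simp only
    rw [radialGrad, mul_smul, enorm_smul, ENNReal.mul_rpow_of_nonneg _ _ (Nat.cast_nonneg N),
      ← ofReal_norm ((‖x‖ ^ 2)⁻¹ • x), e1, ENNReal.ofReal_rpow_of_pos (Real.exp_pos _),
      ← Real.exp_mul]
    ring_nf
  rw [h1, lintegral_log_norm hF]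
  congr 1
  refine lintegral_congr fun τ => ?_
  rw [mul_left_comm, ← ENNReal.ofReal_mul (Real.exp_pos _).le, ← Real.exp_add]
  simp

theorem locallyIntegrable_radialGrad (hN : 1 < N) {G : ℝ → ℝ} (hG : Measurable G)
    (hE : ∫⁻ τ, ‖G τ‖ₑ ^ (N : ℝ) ≠ ⊤) : LocallyIntegrable (radialGrad G : ℝᴺ → ℝᴺ) volume := by
  have hm : MemLp (radialGrad G : ℝᴺ → ℝᴺ) (N : ℝ≥0∞) volume := by
    refine ⟨(measurable_radialGrad hG).aestronglyMeasurable, ?_⟩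
    rw [eLpNorm_eq_lintegral_rpow_enorm_toReal (by simp; omega) (by simp), ENNReal.toReal_natCast,
      lintegral_radialGrad_rpow hN hG]
    exact ENNReal.rpow_lt_top_of_nonneg (by positivity)
      (ENNReal.mul_ne_top (measure_ne_top _ _) hE)
  exact hm.locallyIntegrable (by exact_mod_cast hN.le)

theorem abs_comp_log_norm_le (hN : 1 < N) {G h : ℝ → ℝ} (hG : Measurable G)
    (hE : ∫⁻ τ, ‖G τ‖ₑ ^ (N : ℝ) ≠ ⊤) (hd : ∀ a b, h b - h a = ∫ z in a..b, G z) (τ : ℝ) :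
    |h τ - h 0| ≤ (∫⁻ τ, ‖G τ‖ₑ ^ (N : ℝ)).toReal ^ (1 / (N : ℝ)) * (1 + |τ|) := by
  have hN' : (1 : ℝ) < N := by exact_mod_cast hN
  refine (HasEnergyLE.abs_sub_le hN' hE ⟨G, hG, le_rfl, hd⟩ 0 τ).trans ?_
  gcongr
  rw [sub_zero]
  calc |τ| ^ (1 - 1 / (N : ℝ)) ≤ (1 + |τ|) ^ (1 - 1 / (N : ℝ)) := by
        gcongr
        · rw [sub_nonneg, div_le_one (by linarith)]; exact hN'.le
        · linarith
    _ ≤ (1 + |τ|) ^ (1 : ℝ) := by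
        refine Real.rpow_le_rpow_of_exponent_le (by linarith [abs_nonneg τ]) ?_
        linarith [show (0 : ℝ) ≤ 1 / N by positivity]
    _ = _ := Real.rpow_one _

theorem locallyIntegrable_comp_log_norm (hN : 1 < N) {G h : ℝ → ℝ} (hG : Measurable G)
    (hE : ∫⁻ τ, ‖G τ‖ₑ ^ (N : ℝ) ≠ ⊤) (hd : ∀ a b, h b - h a = ∫ z in a..b, G z) :
    LocallyIntegrable (fun x : ℝᴺ => h (Real.log ‖x‖)) volume := by
  have hN' : (1 : ℝ) < N := by exact_mod_cast hN
  have hc : Continuous h := HasEnergyLE.continuous hN' hE ⟨G, hG, le_rfl, hd⟩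
  have h1 := (locallyIntegrable_one_add_abs_log_norm hN).smul
    ((∫⁻ τ, ‖G τ‖ₑ ^ (N : ℝ)).toReal ^ (1 / (N : ℝ)) + |h 0|)
  refine h1.mono (hc.measurable.comp (by fun_prop)).aestronglyMeasurable
    (Eventually.of_forall fun x => ?_)
  have h2 := abs_comp_log_norm_le hN hG hE hd (Real.log ‖x‖)
  have h3 : |h (Real.log ‖x‖)| ≤ |h (Real.log ‖x‖) - h 0| + |h 0| := by
    simpa using abs_add_le (h (Real.log ‖x‖) - h 0) (h 0)
  simp only [Pi.smul_apply, smul_eq_mul, norm_mul, Real.norm_eq_abs]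
  have e1 : (0 : ℝ) ≤ (∫⁻ τ, ‖G τ‖ₑ ^ (N : ℝ)).toReal ^ (1 / (N : ℝ)) + |h 0| := by positivity
  rw [abs_of_nonneg e1, abs_of_nonneg (show 0 ≤ 1 + |Real.log ‖x‖| by positivity), add_mul]
  nlinarith [mul_nonneg (abs_nonneg (h 0)) (abs_nonneg (Real.log ‖x‖))]

theorem LocallyIntegrable.integrable_comp_mul {g : ℝᴺ → ℝᴺ} (hg : LocallyIntegrable g volume)
    {φ : ℝᴺ → ℝ} (hφ : Continuous φ) (hφc : HasCompactSupport φ) (i : Fin N) :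
    Integrable fun x => g x i * φ x := by
  have h := (EuclideanSpace.proj i : ℝᴺ →L[ℝ] ℝ).integrable_comp
    (hg.integrable_smul_left_of_hasCompactSupport hφ hφc)
  refine h.congr (Eventually.of_forall fun x => ?_)
  simp [mul_comm]

theorem LocallyIntegrable.integrable_mul {u φ : ℝᴺ → ℝ} (hu : LocallyIntegrable u volume)
    (hφ : Continuous φ) (hφc : HasCompactSupport φ) : Integrable fun x => u x * φ x := by
  simpa [mul_comm] using hu.integrable_smul_left_of_hasCompactSupport hφ hφc

theorem integral_radial_of_continuous (hN : 1 < N) {G h : ℝ → ℝ} (hG : Continuous G)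
    (hGc : HasCompactSupport G) (hd : ∀ a b, h b - h a = ∫ z in a..b, G z) {φ : ℝᴺ → ℝ}
    (hφ : ContDiff ℝ (⊤ : ℕ∞) φ) (hφc : HasCompactSupport φ) (i : Fin N) :
    ∫ x, h (Real.log ‖x‖) * fderiv ℝ φ x (EuclideanSpace.single i 1) =
      -∫ x, radialGrad G x i * φ x := by
  obtain ⟨R, hR, hsub⟩ := exists_support_subset_Ioc hGc
  have hz (τ : ℝ) (hτ : τ ∉ Ioo (-R) R) : G τ = 0 := by
    by_contra h0
    exact hτ (hsub (subset_tsupport _ h0))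
  have : NeZero N := ⟨by omega⟩
  have hhd (τ : ℝ) : HasDerivAt h (G τ) τ := by
    have h1 : h = fun x => h 0 + ∫ z in (0 : ℝ)..x, G z := by ext x; rw [← hd]; ring
    rw [h1]
    exact (intervalIntegral.integral_hasDerivAt_right (hG.intervalIntegrable _ _)
      (hG.stronglyMeasurableAtFilter _ _) hG.continuousAt).const_add _
  have hconst (τ : ℝ) (hτ : τ ≤ -R) : h τ = h (-R) := by
    have h1 : h (-R) - h τ = 0 := by
      rw [hd]
      refine (intervalIntegral.integral_congr fun z hz' => hz z fun hz2 => ?_).trans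
        intervalIntegral.integral_zero
      rw [uIcc_of_le hτ] at hz'
      linarith [hz'.2, hz2.1]
    linarith
  set U : ℝᴺ → ℝ := fun x => if x = 0 then h (-R) else h (Real.log ‖x‖) with hU
  have h0 : ∀ᵐ x : ℝᴺ, x ≠ 0 := by simp [ae_iff]
  have hUae : ∀ᵐ x : ℝᴺ, U x = h (Real.log ‖x‖) := h0.mono fun x hx => by simp [hU, hx]
  have hUd (x : ℝᴺ) : HasFDerivAt U (innerSL ℝ (radialGrad G x)) x := by
    rcases eq_or_ne x 0 with rfl | hx
    · have e1 : innerSL ℝ (radialGrad G (0 : ℝᴺ)) = 0 := by simp [radialGrad]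
      rw [e1]
      refine (hasFDerivAt_const (h (-R)) (0 : ℝᴺ)).congr_of_eventuallyEq ?_
      filter_upwards [Metric.ball_mem_nhds (0 : ℝᴺ) (Real.exp_pos (-R))] with y hy
      by_cases hy0 : y = 0
      · simp [hU, hy0]
      · simp only [hU, hy0, if_false]
        rw [mem_ball_zero_iff] at hy
        exact hconst _ ((Real.log_lt_iff_lt_exp (norm_pos_iff.2 hy0)).2 hy).le
    · have e1 : innerSL ℝ (radialGrad G x) =
          G (Real.log ‖x‖) • (‖x‖ ^ 2)⁻¹ • innerSL ℝ x := by
        rw [radialGrad, mul_smul, map_smul, map_smul]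
      rw [e1]
      refine ((hhd (Real.log ‖x‖)).comp_hasFDerivAt x (hasFDerivAt_log_norm hx)).congr_of_eventuallyEq ?_
      filter_upwards [isOpen_ne.mem_nhds hx] with y hy
      have hy' : y ≠ 0 := hy
      simp [hU, hy']
  have hUdiff : Differentiable ℝ U := fun x => (hUd x).differentiableAt
  have hE : ∫⁻ τ, ‖G τ‖ₑ ^ (N : ℝ) ≠ ⊤ := by
    have hm : MemLp G (N : ℝ≥0∞) volume := hG.memLp_of_hasCompactSupport hGc
    have h2 := lintegral_rpow_enorm_lt_top_of_eLpNorm_lt_top (by simp; omega) (by simp) hm.2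
    simpa using h2.ne
  have hgl : LocallyIntegrable (radialGrad G : ℝᴺ → ℝᴺ) volume :=
    locallyIntegrable_radialGrad hN hG.measurable hE
  have hUl : LocallyIntegrable U volume := hUdiff.continuous.locallyIntegrable
  have e2 (x : ℝᴺ) : fderiv ℝ U x (EuclideanSpace.single i 1) = radialGrad G x i := by
    rw [(hUd x).fderiv]
    simp [EuclideanSpace.inner_single_right]
  have hdφ : Continuous fun x => fderiv ℝ φ x (EuclideanSpace.single i 1) :=
    (hφ.continuous_fderiv (by simp)).clm_apply continuous_const
  have key := integral_mul_fderiv_eq_neg_fderiv_mul_of_integrable (μ := (volume : Measure ℝᴺ))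
    (f := U) (g := φ) (v := EuclideanSpace.single i 1)
    (by simp_rw [e2]; exact LocallyIntegrable.integrable_comp_mul hgl hφ.continuous hφc i)
    (LocallyIntegrable.integrable_mul hUl hdφ (hφc.fderiv_apply ℝ _))
    (LocallyIntegrable.integrable_mul hUl hφ.continuous hφc)
    (fun x _ => hUdiff x) (fun x _ => hφ.differentiable (by simp) x)
  simp_rw [e2] at key
  rw [← key]
  exact integral_congr_ae (hUae.mono fun x hx => by simp only [hx])

theorem exists_bound_integral_radial (hN : 1 < N) {φ : ℝᴺ → ℝ} (hφ : ContDiff ℝ (⊤ : ℕ∞) φ)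
    (hφc : HasCompactSupport φ) (i : Fin N) : ∃ C : ℝ≥0∞, C ≠ ⊤ ∧ ∀ G h : ℝ → ℝ, Measurable G →
      ∫⁻ τ, ‖G τ‖ₑ ^ (N : ℝ) ≠ ⊤ → (∀ a b, h b - h a = ∫ z in a..b, G z) → h 0 = 0 →
      ‖(∫ x, h (Real.log ‖x‖) * fderiv ℝ φ x (EuclideanSpace.single i 1)) +
        ∫ x, radialGrad G x i * φ x‖ₑ ≤ (∫⁻ τ, ‖G τ‖ₑ ^ (N : ℝ)) ^ (1 / (N : ℝ)) * C := by
  have hN' : (1 : ℝ) < N := by exact_mod_cast hN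
  set q := (N : ℝ).conjExponent with hq
  have hpq : (N : ℝ).HolderConjugate q := Real.HolderConjugate.conjExponent hN'
  set dφ : ℝᴺ → ℝ := fun x => fderiv ℝ φ x (EuclideanSpace.single i 1) with hdφ'
  have hdφ : Continuous dφ := (hφ.continuous_fderiv (by simp)).clm_apply continuous_const
  have h1 := LocallyIntegrable.integrable_mul (locallyIntegrable_one_add_abs_log_norm hN) hdφ
    (hφc.fderiv_apply ℝ _)
  have h2 : ∫⁻ x, ‖φ x‖ₑ ^ q ≠ ⊤ := by
    have hm : MemLp φ (ENNReal.ofReal q) volume := hφ.continuous.memLp_of_hasCompactSupport hφc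
    have h2 := lintegral_rpow_enorm_lt_top_of_eLpNorm_lt_top
      (by simpa using hpq.symm.pos) (by simp) hm.2
    rw [ENNReal.toReal_ofReal hpq.symm.nonneg] at h2
    exact h2.ne
  refine ⟨(∫⁻ x : ℝᴺ, ‖(1 + |Real.log ‖x‖|) * dφ x‖ₑ) +
    (σ univ) ^ (1 / (N : ℝ)) * (∫⁻ x, ‖φ x‖ₑ ^ q) ^ (1 / q), ?_, ?_⟩
  · refine ENNReal.add_ne_top.2 ⟨h1.hasFiniteIntegral.ne, ENNReal.mul_ne_top ?_ ?_⟩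
    · exact ENNReal.rpow_ne_top_of_nonneg (by positivity) (measure_ne_top _ _)
    · exact ENNReal.rpow_ne_top_of_nonneg (by have := hpq.symm.nonneg; positivity) h2
  intro G h hG hE hd h0
  refine (enorm_add_le _ _).trans ?_
  rw [mul_add]
  refine add_le_add ?_ ?_
  · have hA : (∫⁻ τ, ‖G τ‖ₑ ^ (N : ℝ)) ^ (1 / (N : ℝ)) ≠ ⊤ :=
      ENNReal.rpow_ne_top_of_nonneg (by positivity) hE
    rw [← lintegral_const_mul' _ _ hA]
    refine (enorm_integral_le_lintegral_enorm _).trans (lintegral_mono fun x => ?_)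
    rw [enorm_mul, enorm_mul, ← mul_assoc]
    gcongr
    have h3 := abs_comp_log_norm_le hN hG hE hd (Real.log ‖x‖)
    rw [h0, sub_zero, ENNReal.toReal_rpow] at h3
    rw [Real.enorm_eq_ofReal_abs, Real.enorm_of_nonneg (by positivity), ← ENNReal.ofReal_toReal hA,
      ← ENNReal.ofReal_mul ENNReal.toReal_nonneg]
    exact ENNReal.ofReal_le_ofReal h3
  · have h4 := ENNReal.lintegral_mul_le_Lp_mul_Lq (volume : Measure ℝᴺ) hpq
      (measurable_radialGrad hG).enorm.aemeasurable hφ.continuous.measurable.enorm.aemeasurable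
    rw [lintegral_radialGrad_rpow hN hG, ENNReal.mul_rpow_of_nonneg _ _ (by positivity)] at h4
    calc _ ≤ ∫⁻ x, ‖radialGrad G x i * φ x‖ₑ := enorm_integral_le_lintegral_enorm _
      _ ≤ ∫⁻ x : ℝᴺ, ‖radialGrad G x‖ₑ * ‖φ x‖ₑ := by
        refine lintegral_mono fun x => ?_
        rw [enorm_mul]
        gcongr
        rw [← ofReal_norm, ← ofReal_norm]
        exact ENNReal.ofReal_le_ofReal (PiLp.norm_apply_le _ i)
      _ ≤ _ := h4
      _ = _ := by ring

theorem hasWeakGradient_comp_log_norm (hN : 1 < N) {G h : ℝ → ℝ} (hG : Measurable G)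
    (hE : ∫⁻ τ, ‖G τ‖ₑ ^ (N : ℝ) ≠ ⊤) (hd : ∀ a b, h b - h a = ∫ z in a..b, G z) :
    HasWeakGradient (fun x : ℝᴺ => h (Real.log ‖x‖)) (radialGrad G) := by
  have hN' : (1 : ℝ) < N := by exact_mod_cast hN
  have hul := locallyIntegrable_comp_log_norm (N := N) hN hG hE hd
  have hgl := locallyIntegrable_radialGrad (N := N) hN hG hE
  refine ⟨hul, hgl, fun φ hφ hφc i => ?_⟩
  obtain ⟨C, hC, hbound⟩ := exists_bound_integral_radial hN hφ hφc i
  have hdφ : Continuous fun x => fderiv ℝ φ x (EuclideanSpace.single i 1) :=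
    (hφ.continuous_fderiv (by simp)).clm_apply continuous_const
  have hdφc : HasCompactSupport fun x => fderiv ℝ φ x (EuclideanSpace.single i 1) :=
    hφc.fderiv_apply ℝ _
  have hmem : MemLp G (N : ℝ≥0∞) volume := by
    refine ⟨hG.aestronglyMeasurable, ?_⟩
    rw [eLpNorm_eq_lintegral_rpow_enorm_toReal (by simp; omega) (by simp), ENNReal.toReal_natCast]
    exact ENNReal.rpow_lt_top_of_nonneg (by positivity) hE
  rw [eq_neg_iff_add_eq_zero, ← enorm_eq_zero, ← nonpos_iff_eq_zero]
  refine ENNReal.le_of_forall_pos_le_add fun ε hε _ => ?_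
  rw [zero_add]
  obtain ⟨δ, hδ, hδC⟩ : ∃ δ : ℝ≥0∞, δ ≠ 0 ∧ δ * C ≤ ε := by
    refine ⟨ε / (C + 1), ?_, ?_⟩
    · exact (ENNReal.div_pos (by simpa using hε.ne') (by simp [hC])).ne'
    · calc (ε : ℝ≥0∞) / (C + 1) * C ≤ ε / (C + 1) * (C + 1) := by gcongr; exact le_self_add
        _ ≤ ε := (ENNReal.div_mul_cancel (by simp) (by simp [hC])).le
  obtain ⟨G₁, hG₁c, hδG, hG₁, hG₁m⟩ := hmem.exists_hasCompactSupport_eLpNorm_sub_le (by simp) hδ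
  have hE₁ : ∫⁻ τ, ‖G₁ τ‖ₑ ^ (N : ℝ) ≠ ⊤ := by
    have h2 := lintegral_rpow_enorm_lt_top_of_eLpNorm_lt_top (by simp; omega) (by simp) hG₁m.2
    simpa using h2.ne
  have hE₂ : ∫⁻ τ, ‖G τ - G₁ τ‖ₑ ^ (N : ℝ) ≠ ⊤ := by
    have h2 := lintegral_rpow_enorm_lt_top_of_eLpNorm_lt_top (by simp; omega) (by simp)
      (hmem.sub hG₁m).2
    simpa using h2.ne
  set h₁ : ℝ → ℝ := fun τ => h 0 + ∫ z in (0 : ℝ)..τ, G₁ z with hh₁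
  have hG₁i (a b : ℝ) : IntervalIntegrable G₁ volume a b := hG₁.intervalIntegrable _ _
  have hd₁ (a b : ℝ) : h₁ b - h₁ a = ∫ z in a..b, G₁ z := by
    rw [← intervalIntegral.integral_interval_sub_left (hG₁i 0 b) (hG₁i 0 a)]
    simp [hh₁]
  have hGi := intervalIntegrable_of_lintegral_rpow hN' hE hG le_rfl
  have key := hbound (fun τ => G τ - G₁ τ) (fun τ => h τ - h₁ τ) (hG.sub hG₁.measurable) hE₂
    (fun a b => by
      rw [intervalIntegral.integral_sub (hGi a b) (hG₁i a b), ← hd, ← hd₁]; ring)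
    (by simp [hh₁])
  have hzero := integral_radial_of_continuous hN hG₁ hG₁c hd₁ hφ hφc i
  have i1 := LocallyIntegrable.integrable_mul hul hdφ hdφc
  have i2 := LocallyIntegrable.integrable_mul
    (locallyIntegrable_comp_log_norm (N := N) hN hG₁.measurable hE₁ hd₁) hdφ hdφc
  have i3 := LocallyIntegrable.integrable_comp_mul hgl hφ.continuous hφc i
  have i4 := LocallyIntegrable.integrable_comp_mul
    (locallyIntegrable_radialGrad (N := N) hN hG₁.measurable hE₁) hφ.continuous hφc i
  have e1 : ∫ x : ℝᴺ, (h (Real.log ‖x‖) - h₁ (Real.log ‖x‖)) *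
      fderiv ℝ φ x (EuclideanSpace.single i 1) =
      (∫ x : ℝᴺ, h (Real.log ‖x‖) * fderiv ℝ φ x (EuclideanSpace.single i 1)) -
      ∫ x : ℝᴺ, h₁ (Real.log ‖x‖) * fderiv ℝ φ x (EuclideanSpace.single i 1) := by
    rw [← integral_sub i1 i2]
    simp_rw [sub_mul]
  have e2 : ∫ x : ℝᴺ, radialGrad (fun τ => G τ - G₁ τ) x i * φ x =
      (∫ x : ℝᴺ, radialGrad G x i * φ x) - ∫ x : ℝᴺ, radialGrad G₁ x i * φ x := by
    rw [← integral_sub i3 i4]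
    refine integral_congr_ae (Eventually.of_forall fun x => ?_)
    simp [radialGrad]; ring
  rw [e1, e2, hzero] at key
  have e3 : (∫⁻ τ, ‖G τ - G₁ τ‖ₑ ^ (N : ℝ)) ^ (1 / (N : ℝ)) ≤ δ := by
    rw [eLpNorm_eq_lintegral_rpow_enorm_toReal (by simp; omega) (by simp),
      ENNReal.toReal_natCast] at hδG
    exact hδG
  refine le_trans (le_of_eq ?_) (key.trans ((mul_le_mul_left e3 C).trans hδC))
  congr 1
  ring

theorem sphereArea_eq_toReal_toSphere : sphereArea N = ((σ) univ).toReal := by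
  rw [Measure.toSphere_apply_univ]
  simp [sphereArea]

theorem ae_norm_rpow_eq_exp_log [NeZero N] (r : ℝ) :
    ∀ᵐ x : ℝᴺ, ‖x‖ ^ r = Real.exp (r * Real.log ‖x‖) := by
  filter_upwards [Measure.ae_ne volume (0 : ℝᴺ)] with x hx
  rw [Real.rpow_def_of_pos (norm_pos_iff.2 hx), mul_comm]

theorem lintegral_mul_norm_rpow [NeZero N] {F : ℝ → ℝ} (hF : Continuous F)
    {h : ℝ → ℝ} (hh : Continuous h) {u : ℝᴺ → ℝ} (hu : ∀ᵐ x, u x = h (Real.log ‖x‖)) (r : ℝ) :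
    ∫⁻ x, ENNReal.ofReal (F (u x) * ‖x‖ ^ (-r)) =
      (σ) univ * ∫⁻ τ, ENNReal.ofReal (F (h τ) * Real.exp ((N - r) * τ)) := by
  have h1 : ∫⁻ x, ENNReal.ofReal (F (u x) * ‖x‖ ^ (-r)) =
      ∫⁻ x : ℝᴺ, ENNReal.ofReal (F (h (Real.log ‖x‖)) * Real.exp (-r * Real.log ‖x‖)) := by
    refine lintegral_congr_ae ?_
    filter_upwards [hu, ae_norm_rpow_eq_exp_log (-r)] with x h1 h2
    rw [h1, h2]
  rw [h1, lintegral_log_norm (F := fun τ => ENNReal.ofReal (F (h τ) * Real.exp (-r * τ)))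
    (by fun_prop)]
  congr 1
  refine lintegral_congr fun τ => ?_
  rw [← ENNReal.ofReal_mul (Real.exp_pos _).le, sub_mul, sub_eq_add_neg, Real.exp_add, neg_mul]
  ring_nf

variable {s t α : ℝ}

theorem lintegral_eq_mul_weightedNorm (hN : 1 < N) {h : ℝ → ℝ} (hh : Continuous h) {u : ℝᴺ → ℝ}
    (hu : ∀ᵐ x, u x = h (Real.log ‖x‖)) :
    ∫⁻ x, ENNReal.ofReal (|u x| ^ (N : ℝ) * ‖x‖ ^ (-s)) = (σ) univ * weightedNorm N (N - s) h := by
  have : NeZero N := ⟨by omega⟩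
  exact lintegral_mul_norm_rpow (F := fun z => |z| ^ (N : ℝ))
    (continuous_abs.rpow_const fun _ => Or.inr (by positivity)) hh hu s

theorem Gfunc_eq (hN : 1 < N) {h : ℝ → ℝ} (hh : Continuous h) {u : ℝᴺ → ℝ}
    (hu : ∀ᵐ x, u x = h (Real.log ‖x‖)) (hs : s < N) (ht : t < N) :
    Gfunc N s t α u = (σ) univ / (σ) univ ^ ((N - t) / (N - s)) *
      (expFunctional N α 0 (N - t) h / weightedNorm N (N - s) h ^ ((N - t) / (N - s))) := by
  have : NeZero N := ⟨by omega⟩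
  have hN' : (1 : ℝ) < N := by exact_mod_cast hN
  have hr : 0 ≤ (N - t) / (N - s) := div_nonneg (by linarith) (by linarith)
  have hc : Continuous fun z : ℝ =>
      Real.exp (α * |z| ^ ((N : ℝ) / ((N : ℝ) - 1))) * |z| ^ (N : ℝ) := by
    have h1 : Continuous fun z : ℝ => |z| ^ ((N : ℝ) / ((N : ℝ) - 1)) :=
      continuous_abs.rpow_const fun _ => Or.inr (div_nonneg (by linarith) (by linarith))
    have h2 : Continuous fun z : ℝ => |z| ^ (N : ℝ) :=
      continuous_abs.rpow_const fun _ => Or.inr (by linarith)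
    fun_prop
  have hA : ∫⁻ x, ENNReal.ofReal (Real.exp (α * |u x| ^ ((N : ℝ) / ((N : ℝ) - 1))) *
      |u x| ^ (N : ℝ) * ‖x‖ ^ (-t)) = (σ) univ * expFunctional N α 0 (N - t) h := by
    rw [lintegral_mul_norm_rpow hc hh hu t]
    simp [expFunctional, expDensity]
  rw [Gfunc, hA, lintegral_eq_mul_weightedNorm hN hh hu, ENNReal.mul_rpow_of_nonneg _ _ hr,
    ENNReal.mul_div_mul_comm]
  · left
    exact (ENNReal.rpow_pos (pos_iff_ne_zero.2 toSphere_univ_ne_zero) (measure_ne_top _ _)).ne'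
  · left
    exact ENNReal.rpow_ne_top_of_nonneg hr (measure_ne_top _ _)

end EuclideanRadial

end

/-- **Proposition 5.4.** For `N ≥ 2`, `s ≤ t < N`, `0 < α < α_{N,t}`, the sharp constant
`ν_{N,s,t,α,rad}(ℝ^N) = sup { G_{N,s,t,α}(u) : u ∈ X^{1,N}_{s,rad}, ‖∇u‖_{L^N} = 1 }`
is attained by a radially symmetric function. -/
theorem nu_rad_attained (N : ℕ) (hN : 2 ≤ N) (s t : ℝ) (hst : s ≤ t) (htN : t < (N : ℝ))
    (α : ℝ) (hα0 : 0 < α)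
    (hα : α < ((N : ℝ) - t) * sphereArea N ^ (1 / ((N : ℝ) - 1))) :
    ∃ u : EuclideanSpace ℝ (Fin N) → ℝ, AdmissibleXrad N s u ∧
      Gfunc N s t α u =
        ⨆ (u' : EuclideanSpace ℝ (Fin N) → ℝ) (_ : AdmissibleXrad N s u'),
          Gfunc N s t α u' := by
  have : NeZero N := ⟨by omega⟩
  have hN1 : 1 < N := by omega
  have hp : (1 : ℝ) < N := by exact_mod_cast hN1
  set ω : ℝ≥0∞ := Measure.toSphere (volume : Measure (EuclideanSpace ℝ (Fin N))) Set.univ with hω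
  have hω0 : ω ≠ 0 := toSphere_univ_ne_zero
  have hωt : ω ≠ ⊤ := measure_ne_top _ _
  have hpos : 0 < ω.toReal := ENNReal.toReal_pos hω0 hωt
  have hsub : α * (ω⁻¹.toReal ^ (1 / (N : ℝ))) ^ ((N : ℝ) / ((N : ℝ) - 1)) < N - t := by
    have h1 : (1 / (N : ℝ)) * ((N : ℝ) / ((N : ℝ) - 1)) = 1 / ((N : ℝ) - 1) := by
      have : (N : ℝ) ≠ 0 := by positivity
      field_simp
    rw [← Real.rpow_mul ENNReal.toReal_nonneg, h1, ENNReal.toReal_inv,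
      Real.inv_rpow hpos.le, ← div_eq_mul_inv, div_lt_iff₀ (Real.rpow_pos_of_pos hpos _)]
    rwa [sphereArea_eq_toReal_toSphere] at hα
  obtain ⟨h, G, hG, hGE, hd, hwt, hmax⟩ := exists_maximizer_expFunctional hp
    (ENNReal.inv_ne_zero.2 hωt) (ENNReal.inv_ne_top.2 hω0) hα0 (a := N - s) (by linarith)
    (by linarith) hsub
  have henergy (g : EuclideanSpace ℝ (Fin N) → EuclideanSpace ℝ (Fin N)) :
      ∫⁻ x, ENNReal.ofReal (‖g x‖ ^ (N : ℝ)) = ∫⁻ x, ‖g x‖ₑ ^ (N : ℝ) := by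
    refine lintegral_congr fun x => ?_
    rw [← ofReal_norm, ENNReal.ofReal_rpow_of_nonneg (norm_nonneg _) (by positivity)]
  have hcont : Continuous h :=
    HasEnergyLE.continuous hp (ENNReal.inv_ne_top.2 hω0) ⟨G, hG, hGE.le, hd⟩
  have hadm : AdmissibleXrad N s fun x => h (Real.log ‖x‖) := by
    refine ⟨fun x y hxy => by simp only [hxy], ⟨radialGrad G,
      hasWeakGradient_comp_log_norm hN1 hG (hGE ▸ ENNReal.inv_ne_top.2 hω0) hd, ?_⟩, ?_⟩
    · rw [henergy, lintegral_radialGrad_rpow hN1 hG, hGE, ENNReal.mul_inv_cancel hω0 hωt]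
    · rw [lintegral_eq_mul_weightedNorm hN1 hcont (.of_forall fun x => rfl)]
      exact ENNReal.mul_ne_top hωt hwt
  refine ⟨_, hadm, le_antisymm (le_iSup₂_of_le _ hadm le_rfl) (iSup₂_le fun u hu => ?_)⟩
  obtain ⟨hrad, ⟨g, hug, hg⟩, hfin⟩ := hu
  rw [henergy] at hg
  obtain ⟨f, hf, huf⟩ := hug.exists_hasEnergyLE hN1 hrad (hg.trans_ne ENNReal.one_ne_top)
  rw [hg, mul_one] at hf
  have hfc := hf.continuous hp (ENNReal.inv_ne_top.2 hω0)
  have hfw : weightedNorm N (N - s) f ≠ ⊤ := by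
    rw [lintegral_eq_mul_weightedNorm hN1 hfc huf] at hfin
    exact fun h1 => hfin (by rw [h1, ENNReal.mul_top hω0])
  rw [Gfunc_eq hN1 hfc huf (hst.trans_lt htN) htN,
    Gfunc_eq hN1 hcont (.of_forall fun x => rfl) (hst.trans_lt htN) htN]
  exact mul_le_mul_right (hmax f hf hfw) _
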